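/- arXiv:2311.14259 — 5 statements merged into one kernel-verified Lean document; each statement's English description precedes it below -/
import Mathlib

section
/- Let C1, C2 be nonnegative integers with C1 ≡ C2 (mod 2), let C3 be an integer, and let C4, C5 be positive integers. Set C* = C3 + (C1 - C2)(C1 + C2)/4 (an integer). Then the Diophantine equation (x² + C1·x) - (y² + C2·y) = C3 has a solution with (x,y) ∈ [C4] × [C5] if and only if C* has a positive divisor p ∈ ℕ with p > √|C*| such that: (i) C1 + 2 ≤ p + C*/p ≤ C1 + 2·C4; (ii) C2 + 2 ≤ p - C*/p ≤ C2 + 2·C5; (iii) p + C*/p ≡ C1 (mod 2). -/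
/-- The Diophantine equation `(x² + C₁x) - (y² + C₂y) = C₃` has a solution in
`[C₄] × [C₅]` if and only if `C* = C₃ + (C₁ - C₂)(C₁ + C₂)/4` has a positive
divisor `p > √|C*|` satisfying the three stated conditions. -/
theorem dio_eq_solvable_iff (C1 C2 : ℕ) (hpar : C1 % 2 = C2 % 2) (C3 : ℤ)
    (C4 C5 : ℕ) (hC4 : 0 < C4) (hC5 : 0 < C5) (Cstar : ℤ)
    (hCstar : 4 * Cstar = 4 * C3 + ((C1 : ℤ) - (C2 : ℤ)) * ((C1 : ℤ) + (C2 : ℤ))) :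
    (∃ x y : ℤ, 1 ≤ x ∧ x ≤ C4 ∧ 1 ≤ y ∧ y ≤ C5 ∧
        (x ^ 2 + C1 * x) - (y ^ 2 + C2 * y) = C3) ↔
      ∃ p : ℤ, 0 < p ∧ p ∣ Cstar ∧ Real.sqrt |(Cstar : ℝ)| < (p : ℝ) ∧
        ((C1 : ℤ) + 2 ≤ p + Cstar / p ∧ p + Cstar / p ≤ (C1 : ℤ) + 2 * C4) ∧
        ((C2 : ℤ) + 2 ≤ p - Cstar / p ∧ p - Cstar / p ≤ (C2 : ℤ) + 2 * C5) ∧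
        p + Cstar / p ≡ (C1 : ℤ) [ZMOD 2] := by
  constructor
  · rintro ⟨x, y, hx1, hx2, hy1, hy2, hxy⟩
    obtain ⟨m, hm⟩ : ∃ m : ℤ, (C1 : ℤ) = C2 + 2 * m := ⟨((C1 : ℤ) - C2) / 2, by omega⟩
    obtain ⟨p, hp⟩ : ∃ p : ℤ, p = x + y + C2 + m := ⟨_, rfl⟩
    obtain ⟨q, hq⟩ : ∃ q : ℤ, q = x - y + m := ⟨_, rfl⟩
    have hfac : Cstar = p * q := by
      rw [hm] at hxy hCstar
      subst hp hq
      linarith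
    have hpos : 0 < p := by omega
    have hdiv : Cstar / p = q := by rw [hfac, Int.mul_ediv_cancel_left _ hpos.ne']
    have hlt : |Cstar| < p ^ 2 := by
      rw [hfac, abs_mul, abs_of_pos hpos, sq]
      exact mul_lt_mul_of_pos_left (abs_lt.2 ⟨by omega, by omega⟩) hpos
    refine ⟨p, hpos, ⟨q, hfac⟩, ?_, ?_⟩
    · rw [Real.sqrt_lt' (by exact_mod_cast hpos)]
      exact_mod_cast hlt
    · rw [hdiv, Int.ModEq]
      omega
  · rintro ⟨p, hpos, ⟨q, hfac⟩, -, h⟩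
    rw [hfac, Int.mul_ediv_cancel_left _ hpos.ne', Int.ModEq] at h
    obtain ⟨⟨hx1, hx2⟩, ⟨hy1, hy2⟩, hmod⟩ := h
    obtain ⟨x, hx⟩ : ∃ x : ℤ, p + q = C1 + 2 * x := ⟨(p + q - C1) / 2, by omega⟩
    obtain ⟨y, hy⟩ : ∃ y : ℤ, p - q = C2 + 2 * y := ⟨(p - q - C2) / 2, by omega⟩
    refine ⟨x, y, by omega, by omega, by omega, by omega, ?_⟩
    have hsq : 4 * (p * q) = (C1 + 2 * x) ^ 2 - (C2 + 2 * y) ^ 2 := by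
      rw [← hx, ← hy]
      ring
    rw [← hfac] at hsq
    linarith
end

section
/- Let k ≥ 3 and A_1, A_2, ..., A_k be positive integers, and let n = 1 + A_1 + ... + A_k. If A_i ≥ n/2 holds for some 1 ≤ i ≤ k, then the starlike tree S(A_1, A_2, ..., A_k) is not transmission irregular. -/
/-- The transmission of a vertex: sum of distances to all other vertices. -/
noncomputable def transmission {V : Type*} [Fintype V] (G : SimpleGraph V) (u : V) : ℕ :=
  ∑ v : V, G.dist u v

/-- A graph is transmission irregular if all vertices have distinct transmissions. -/
def TransmissionIrregular {V : Type*} [Fintype V] (G : SimpleGraph V) : Prop :=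
  Function.Injective (transmission G)

/-- The starlike tree `S(A 0, …, A (k-1))`: a central vertex (`none`) with `k`
pendent paths attached, the `i`-th of length `A i`; `some ⟨i, j⟩` is the
`(j+1)`-st vertex on the `i`-th pendent path. -/
def starlikeTree (k : ℕ) (A : Fin k → ℕ) :
    SimpleGraph (Option ((i : Fin k) × Fin (A i))) :=
  SimpleGraph.fromRel (fun x y =>
    match x, y with
    | none, some ⟨_, j⟩ => j.val = 0
    | some ⟨i, j⟩, some ⟨i', j'⟩ => i.val = i'.val ∧ j.val + 1 = j'.val
    | _, _ => False)

/-- A function that vanishes only at `u`, grows by at most one along edges, and can be decreased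
by one along some edge wherever it is nonzero, is the distance from `u`. -/
theorem SimpleGraph.dist_eq_of_descent {V : Type*} (G : SimpleGraph V) (u : V) (f : V → ℕ)
    (hf : ∀ v, f v = 0 ↔ v = u) (hlip : ∀ v w, G.Adj v w → f w ≤ f v + 1)
    (hdesc : ∀ v, f v ≠ 0 → ∃ w, G.Adj w v ∧ f w + 1 = f v) (v : V) :
    G.dist u v = f v := by
  have upper : ∀ m v, f v = m → ∃ p : G.Walk u v, p.length = m := by
    intro m
    induction m with
    | zero =>
      intro v hv
      obtain rfl := (hf v).1 hv
      exact ⟨.nil, rfl⟩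
    | succ m ih =>
      intro v hv
      obtain ⟨w, hw, hwv⟩ := hdesc v (by omega)
      obtain ⟨p, hp⟩ := ih w (by omega)
      exact ⟨p.concat hw, by simp [hp]⟩
  have lower : ∀ {x y : V} (p : G.Walk x y), f y ≤ f x + p.length := by
    intro x y p
    induction p with
    | nil => simp
    | cons h p ih =>
      have := hlip _ _ h
      rw [SimpleGraph.Walk.length_cons]
      omega
  obtain ⟨p, hp⟩ := upper _ v rfl
  refine le_antisymm (hp ▸ SimpleGraph.dist_le p) ?_
  obtain ⟨r, hr⟩ := p.reachable.exists_walk_length_eq_dist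
  have h := lower r
  rw [(hf u).2 rfl] at h
  omega

theorem starlikeTree_adj_none_some {k : ℕ} {A : Fin k → ℕ} {i : Fin k} {j : Fin (A i)} :
    (starlikeTree k A).Adj none (some ⟨i, j⟩) ↔ j.val = 0 := by
  simp [starlikeTree]

theorem starlikeTree_adj_some_some {k : ℕ} {A : Fin k → ℕ} {i i' : Fin k} {j : Fin (A i)}
    {j' : Fin (A i')} :
    (starlikeTree k A).Adj (some ⟨i, j⟩) (some ⟨i', j'⟩) ↔
      i = i' ∧ (j.val + 1 = j'.val ∨ j'.val + 1 = j.val) := by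
  simp only [starlikeTree, SimpleGraph.fromRel_adj]
  constructor
  · rintro ⟨-, ⟨h, h'⟩ | ⟨h, h'⟩⟩
    · exact ⟨Fin.ext h, .inl h'⟩
    · exact ⟨Fin.ext h.symm, .inr h'⟩
  · rintro ⟨rfl, h⟩
    refine ⟨?_, by simpa using h⟩
    intro he
    simp only [Option.some.injEq, Sigma.mk.injEq, heq_eq_eq, true_and] at he
    subst he
    omega

theorem starlikeTree_dist_none_some {k : ℕ} {A : Fin k → ℕ} (i : Fin k) (j : Fin (A i)) :
    (starlikeTree k A).dist none (some ⟨i, j⟩) = j.val + 1 := by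
  refine SimpleGraph.dist_eq_of_descent (starlikeTree k A) none
    (fun v => v.elim 0 fun x : (i : Fin k) × Fin (A i) => x.2.val + 1) ?_ ?_ ?_ (some ⟨i, j⟩)
  · rintro (_ | ⟨i, j⟩) <;> simp
  · rintro (_ | ⟨i, j⟩) (_ | ⟨i', j'⟩) h
    · simp
    · simp [starlikeTree_adj_none_some.1 h]
    · simp
    · have := (starlikeTree_adj_some_some.1 h).2
      simp only [Option.elim_some]
      omega
  · rintro (_ | ⟨i, j, hj⟩) h
    · simp at h
    · rcases j with _ | j
      · exact ⟨none, starlikeTree_adj_none_some.2 rfl, rfl⟩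
      · exact ⟨some ⟨i, j, by omega⟩, starlikeTree_adj_some_some.2 ⟨rfl, .inl rfl⟩, rfl⟩

theorem starlikeTree_dist_some_some {k : ℕ} {A : Fin k → ℕ} (i : Fin k) (q : Fin (A i))
    (i' : Fin k) (j : Fin (A i')) :
    (starlikeTree k A).dist (some ⟨i, q⟩) (some ⟨i', j⟩) =
      if i' = i then (q.val - j.val) + (j.val - q.val) else q.val + 1 + (j.val + 1) := by
  refine SimpleGraph.dist_eq_of_descent (starlikeTree k A) (some ⟨i, q⟩)
    (fun v => v.elim (q.val + 1) fun x : (i : Fin k) × Fin (A i) =>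
      if x.1 = i then (q.val - x.2.val) + (x.2.val - q.val) else q.val + 1 + (x.2.val + 1))
    ?_ ?_ ?_ (some ⟨i', j⟩)
  · rintro (_ | ⟨i', j⟩)
    · simp
    · by_cases hi : i' = i
      · subst hi
        simp [Fin.ext_iff]
        omega
      · simp [hi]
  · rintro (_ | ⟨i₁, j₁⟩) (_ | ⟨i₂, j₂⟩) h
    · simp
    · have := starlikeTree_adj_none_some.1 h
      simp only [Option.elim_some, Option.elim_none]
      split_ifs <;> omega
    · have := starlikeTree_adj_none_some.1 h.symm
      simp only [Option.elim_some, Option.elim_none]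
      split_ifs <;> omega
    · obtain ⟨rfl, h⟩ := starlikeTree_adj_some_some.1 h
      simp only [Option.elim_some]
      split_ifs <;> omega
  · rintro (_ | ⟨i', j, hj⟩) h
    · exact ⟨some ⟨i, 0, Nat.zero_lt_of_lt q.isLt⟩, (starlikeTree_adj_none_some.2 rfl).symm, by simp⟩
    · by_cases hi : i' = i
      · subst hi
        simp only [Option.elim_some, if_true] at h
        rcases lt_or_ge j q.val with hjq | hjq
        · refine ⟨some ⟨i', j + 1, by omega⟩, starlikeTree_adj_some_some.2 ⟨rfl, .inr rfl⟩, ?_⟩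
          simp only [Option.elim_some, if_true]
          omega
        · refine ⟨some ⟨i', j - 1, by omega⟩,
            starlikeTree_adj_some_some.2 ⟨rfl, .inl (by simp only; omega)⟩, ?_⟩
          simp only [Option.elim_some, if_true]
          omega
      · rcases j with _ | j
        · exact ⟨none, starlikeTree_adj_none_some.2 rfl, by simp [hi]⟩
        · refine ⟨some ⟨i', j, by omega⟩, starlikeTree_adj_some_some.2 ⟨rfl, .inl rfl⟩, ?_⟩
          simp only [Option.elim_some, hi, if_false]
          omega

theorem sum_range_succ_eq_mul_add_sum_dist (q m : ℕ) :
    ∑ j ∈ Finset.range (q + 1 + m), (j + 1) =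
      (m + 1) * (q + 1) + ∑ j ∈ Finset.range (q + 1 + m), ((q - j) + (j - q)) := by
  induction m with
  | zero =>
    have h : ∑ j ∈ Finset.range (q + 1), ((q - j) + (j - q)) = ∑ j ∈ Finset.range (q + 1), j := by
      rw [← Finset.sum_range_reflect (fun j => j)]
      refine Finset.sum_congr rfl fun j hj => ?_
      have := Finset.mem_range.1 hj
      omega
    rw [add_zero, h, Finset.sum_add_distrib]
    simp [add_comm]
  | succ m ih =>
    rw [← add_assoc, Finset.sum_range_succ, ih, Finset.sum_range_succ _ (q + 1 + m),
      show q - (q + 1 + m) + (q + 1 + m - q) = m + 1 by omega]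
    ring

/-- If `A_i ≥ n/2` for some branch `i`, where `n = 1 + A₁ + ⋯ + A_k` is the order,
then the starlike tree `S(A₁, …, A_k)` is not transmission irregular. -/
theorem starlike_not_TI_of_long_branch (k : ℕ) (hk : 3 ≤ k)
    (A : Fin k → ℕ) (hA : ∀ i, 0 < A i) (n : ℕ) (hn : n = 1 + ∑ i, A i)
    (h : ∃ i : Fin k, n ≤ 2 * A i) :
    ¬ TransmissionIrregular (starlikeTree k A) := by
  obtain ⟨i, hi⟩ := h
  have hsplit := Finset.add_sum_erase Finset.univ A (Finset.mem_univ i)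
  set R := ∑ x ∈ Finset.univ.erase i, A x with hR
  obtain ⟨q, hq⟩ : ∃ q, A i = q + 1 + R := ⟨A i - 1 - R, by omega⟩
  intro hinj
  suffices h : transmission (starlikeTree k A) none =
      transmission (starlikeTree k A) (some ⟨i, q, by omega⟩) by
    simpa using hinj h
  have hbranch : ∑ j : Fin (A i), (j.val + 1) =
      (R + 1) * (q + 1) + ∑ j : Fin (A i), ((q - j.val) + (j.val - q)) := by
    rw [Fin.sum_univ_eq_sum_range (fun j => j + 1),
      Fin.sum_univ_eq_sum_range (fun j => (q - j) + (j - q)), hq]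
    exact sum_range_succ_eq_mul_add_sum_dist q R
  have hother : ∑ x ∈ Finset.univ.erase i, ∑ j : Fin (A x),
        (if x = i then (q - j.val) + (j.val - q) else q + 1 + (j.val + 1)) =
      R * (q + 1) + ∑ x ∈ Finset.univ.erase i, ∑ j : Fin (A x), (j.val + 1) := by
    rw [hR, Finset.sum_mul, ← Finset.sum_add_distrib]
    refine Finset.sum_congr rfl fun x hx => ?_
    simp [Finset.ne_of_mem_erase hx, Finset.sum_add_distrib, mul_add]
  simp only [transmission, Fintype.sum_option, Fintype.sum_sigma, SimpleGraph.dist_self,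
    starlikeTree_dist_none_some, starlikeTree_dist_some_some]
  rw [SimpleGraph.dist_comm, starlikeTree_dist_none_some,
    ← Finset.add_sum_erase _ _ (Finset.mem_univ i), hbranch,
    ← Finset.add_sum_erase Finset.univ (fun x => ∑ j : Fin (A x), ite _ _ _) (Finset.mem_univ i),
    hother]
  simp only [if_true]
  ring
end

section
/- Let C, A_1, ..., A_k, B_1, ..., B_m be positive integers with k, m ≥ 2, let A_* = A_1 + ... + A_k and B_* = B_1 + ... + B_m, and let n = 1 + C + A_* + B_* be the order of the double starlike tree DS(C; A_1, ..., A_k; B_1, ..., B_m). If A_i ≥ n/2 holds for some 1 ≤ i ≤ k, or B_i ≥ n/2 holds for some 1 ≤ i ≤ m, or 1 + A_* ≤ n/2 holds, then DS(C; A_1, ..., A_k; B_1, ..., B_m) is not transmission irregular. -/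
/-- The double starlike tree `DS(C; A; B)`: an internal path `Sum.inl 0, …, Sum.inl C`
of length `C`, with `k` pendent paths of lengths `A i` attached at `Sum.inl 0`
(vertices `Sum.inr (Sum.inl ⟨i, j⟩)`), and `m` pendent paths of lengths `B i`
attached at `Sum.inl C` (vertices `Sum.inr (Sum.inr ⟨i, j⟩)`). -/
def doubleStarlikeTree (C k m : ℕ) (A : Fin k → ℕ) (B : Fin m → ℕ) :
    SimpleGraph (Fin (C + 1) ⊕ ((i : Fin k) × Fin (A i)) ⊕ ((i : Fin m) × Fin (B i))) :=
  SimpleGraph.fromRel (fun x y =>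
    match x, y with
    | Sum.inl c, Sum.inl c' => c.val + 1 = c'.val
    | Sum.inl c, Sum.inr (Sum.inl ⟨_, j⟩) => c.val = 0 ∧ j.val = 0
    | Sum.inl c, Sum.inr (Sum.inr ⟨_, j⟩) => c.val = C ∧ j.val = 0
    | Sum.inr (Sum.inl ⟨i, j⟩), Sum.inr (Sum.inl ⟨i', j'⟩) => i.val = i'.val ∧ j.val + 1 = j'.val
    | Sum.inr (Sum.inr ⟨i, j⟩), Sum.inr (Sum.inr ⟨i', j'⟩) => i.val = i'.val ∧ j.val + 1 = j'.val
    | _, _ => False)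

namespace SimpleGraph

variable {V W : Type*} {G : SimpleGraph V} {H : SimpleGraph W}

/-- A 1-Lipschitz function that vanishes at `u` and decreases towards `u` along some edge at
every other vertex is the distance from `u`. -/
theorem dist_eq_of_lipschitz_of_exists_pred {u : V} {d : V → ℕ} (h0 : d u = 0)
    (hlip : ∀ v w, G.Adj v w → d w ≤ d v + 1)
    (hpred : ∀ v, v = u ∨ ∃ w, G.Adj w v ∧ d w + 1 = d v) (v : V) :
    G.dist u v = d v := by
  have hwalk : ∀ l v, d v = l → ∃ p : G.Walk u v, p.length = l := by
    intro l
    induction l with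
    | zero =>
      intro v hv
      obtain rfl | ⟨w, -, hw⟩ := hpred v
      · exact ⟨.nil, rfl⟩
      · omega
    | succ l ih =>
      intro v hv
      obtain rfl | ⟨w, hwv, hw⟩ := hpred v
      · omega
      · obtain ⟨p, hp⟩ := ih w (by omega)
        exact ⟨p.concat hwv, by simp [hp]⟩
  have hlen : ∀ {x y : V} (p : G.Walk x y), d y ≤ d x + p.length := by
    intro x y p
    induction p with
    | nil => simp
    | cons h p ih =>
      have := hlip _ _ h
      rw [Walk.length_cons]
      omega
  obtain ⟨p, hp⟩ := hwalk _ v rfl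
  obtain ⟨q, hq⟩ := p.reachable.exists_walk_length_eq_dist
  have hle := dist_le p
  have hge := hlen q
  omega

theorem Iso.dist_map_le (φ : G ≃g H) (u v : V) (h : G.Reachable u v) :
    H.dist (φ u) (φ v) ≤ G.dist u v := by
  obtain ⟨p, hp⟩ := h.exists_walk_length_eq_dist
  rw [← hp, ← Walk.length_map φ.toHom p]
  exact dist_le _

theorem Iso.dist_eq (φ : G ≃g H) (u v : V) : H.dist (φ u) (φ v) = G.dist u v := by
  by_cases h : G.Reachable u v
  · refine (φ.dist_map_le u v h).antisymm ?_
    simpa using φ.symm.dist_map_le (φ u) (φ v) (φ.reachable_iff.2 h)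
  · rw [dist_eq_zero_of_not_reachable h,
      dist_eq_zero_of_not_reachable fun h' => h (φ.reachable_iff.1 h')]

theorem Iso.transmission_eq [Fintype V] [Fintype W] (φ : G ≃g H) (u : V) :
    transmission H (φ u) = transmission G u :=
  (Fintype.sum_equiv φ.toEquiv _ _ fun v => (φ.dist_eq u v).symm).symm

end SimpleGraph

namespace doubleStarlikeTree

variable {C k m : ℕ} {A : Fin k → ℕ} {B : Fin m → ℕ}

theorem adj_path {a b : Fin (C + 1)} (h : a.val + 1 = b.val) :
    (doubleStarlikeTree C k m A B).Adj (.inl a) (.inl b) := by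
  refine (SimpleGraph.fromRel_adj _ _ _).2 ⟨?_, .inl h⟩
  simp only [ne_eq, Sum.inl.injEq, Fin.ext_iff]
  omega

theorem adj_left {i : Fin k} {a b : Fin (A i)} (h : a.val + 1 = b.val) :
    (doubleStarlikeTree C k m A B).Adj (.inr (.inl ⟨i, a⟩)) (.inr (.inl ⟨i, b⟩)) := by
  refine (SimpleGraph.fromRel_adj _ _ _).2 ⟨?_, .inl ⟨rfl, h⟩⟩
  simp [Fin.ext_iff]
  omega

theorem adj_right {i : Fin m} {a b : Fin (B i)} (h : a.val + 1 = b.val) :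
    (doubleStarlikeTree C k m A B).Adj (.inr (.inr ⟨i, a⟩)) (.inr (.inr ⟨i, b⟩)) := by
  refine (SimpleGraph.fromRel_adj _ _ _).2 ⟨?_, .inl ⟨rfl, h⟩⟩
  simp [Fin.ext_iff]
  omega

theorem adj_path_left {c : Fin (C + 1)} {i : Fin k} {a : Fin (A i)} (hc : c.val = 0)
    (ha : a.val = 0) :
    (doubleStarlikeTree C k m A B).Adj (.inl c) (.inr (.inl ⟨i, a⟩)) :=
  (SimpleGraph.fromRel_adj _ _ _).2 ⟨by simp, .inl ⟨hc, ha⟩⟩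

theorem adj_path_right {c : Fin (C + 1)} {i : Fin m} {a : Fin (B i)} (hc : c.val = C)
    (ha : a.val = 0) :
    (doubleStarlikeTree C k m A B).Adj (.inl c) (.inr (.inr ⟨i, a⟩)) :=
  (SimpleGraph.fromRel_adj _ _ _).2 ⟨by simp, .inl ⟨hc, ha⟩⟩

/-- The distance from the vertex `Sum.inl c` of the internal path. -/
def distPath (c : ℕ) :
    Fin (C + 1) ⊕ ((i : Fin k) × Fin (A i)) ⊕ ((i : Fin m) × Fin (B i)) → ℕ
  | .inl c' => (c - c') + (c' - c)
  | .inr (.inl ⟨_, j⟩) => c + j + 1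
  | .inr (.inr ⟨_, j⟩) => (C - c) + j + 1

/-- The distance from the vertex `Sum.inr (Sum.inl ⟨i, j⟩)` of a pendent path. -/
def distLeft (i : Fin k) (j : ℕ) :
    Fin (C + 1) ⊕ ((i : Fin k) × Fin (A i)) ⊕ ((i : Fin m) × Fin (B i)) → ℕ
  | .inl c => j + 1 + c
  | .inr (.inl ⟨i', j'⟩) => if i' = i then (j - j') + (j' - j) else j + j' + 2
  | .inr (.inr ⟨_, j'⟩) => j + C + j' + 2

theorem dist_path (c : Fin (C + 1))
    (v : Fin (C + 1) ⊕ ((i : Fin k) × Fin (A i)) ⊕ ((i : Fin m) × Fin (B i))) :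
    (doubleStarlikeTree C k m A B).dist (.inl c) v = distPath c v := by
  have hc := c.isLt
  refine SimpleGraph.dist_eq_of_lipschitz_of_exists_pred (by simp [distPath]) ?_ ?_ v
  · intro v w h
    obtain ⟨-, h⟩ := (SimpleGraph.fromRel_adj _ _ _).1 h
    rcases v with ⟨a, ha⟩ | ⟨i, a, ha⟩ | ⟨i, a, ha⟩ <;>
    rcases w with ⟨b, hb⟩ | ⟨j, b, hb⟩ | ⟨j, b, hb⟩ <;>
    simp only [distPath, or_false, false_or, or_self] at h ⊢ <;> omega
  · rintro (⟨a, ha⟩ | ⟨i, a, ha⟩ | ⟨i, a, ha⟩)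
    · rcases lt_trichotomy a c.val with h | h | h
      · exact .inr ⟨.inl ⟨a + 1, by omega⟩, (adj_path rfl).symm, by simp only [distPath]; omega⟩
      · exact .inl (by simp [h])
      · exact .inr ⟨.inl ⟨a - 1, by omega⟩, adj_path (by simp only; omega),
          by simp only [distPath]; omega⟩
    · rcases a with _ | a
      · exact .inr ⟨.inl ⟨0, by omega⟩, adj_path_left rfl rfl, by simp only [distPath]; omega⟩
      · exact .inr ⟨.inr (.inl ⟨i, a, by omega⟩), adj_left rfl, by simp only [distPath]; omega⟩
    · rcases a with _ | a
      · exact .inr ⟨.inl ⟨C, by omega⟩, adj_path_right rfl rfl, by simp only [distPath]; omega⟩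
      · exact .inr ⟨.inr (.inr ⟨i, a, by omega⟩), adj_right rfl, by simp only [distPath]; omega⟩

theorem dist_left (i : Fin k) (j : Fin (A i))
    (v : Fin (C + 1) ⊕ ((i : Fin k) × Fin (A i)) ⊕ ((i : Fin m) × Fin (B i))) :
    (doubleStarlikeTree C k m A B).dist (.inr (.inl ⟨i, j⟩)) v = distLeft i j v := by
  have hj := j.isLt
  refine SimpleGraph.dist_eq_of_lipschitz_of_exists_pred (by simp [distLeft]) ?_ ?_ v
  · intro v w h
    obtain ⟨-, h⟩ := (SimpleGraph.fromRel_adj _ _ _).1 h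
    rcases v with ⟨a, ha⟩ | ⟨i₁, a, ha⟩ | ⟨i₁, a, ha⟩ <;>
    rcases w with ⟨b, hb⟩ | ⟨i₂, b, hb⟩ | ⟨i₂, b, hb⟩ <;>
    simp only [distLeft, or_false, false_or, or_self, Fin.ext_iff] at h ⊢ <;>
    (try split_ifs) <;> omega
  · rintro (⟨a, ha⟩ | ⟨i', a, ha⟩ | ⟨i', a, ha⟩)
    · rcases a with _ | a
      · exact .inr ⟨.inr (.inl ⟨i, 0, by omega⟩), (adj_path_left rfl rfl).symm,
          by simp [distLeft]⟩
      · exact .inr ⟨.inl ⟨a, by omega⟩, adj_path rfl, by simp only [distLeft]; omega⟩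
    · by_cases hi : i' = i
      · subst hi
        rcases lt_trichotomy a j.val with h | h | h
        · exact .inr ⟨.inr (.inl ⟨i', a + 1, by omega⟩), (adj_left rfl).symm,
            by simp only [distLeft, if_true]; omega⟩
        · exact .inl (by simp [h])
        · exact .inr ⟨.inr (.inl ⟨i', a - 1, by omega⟩), adj_left (by simp only; omega),
            by simp only [distLeft, if_true]; omega⟩
      · rcases a with _ | a
        · exact .inr ⟨.inl ⟨0, by omega⟩, adj_path_left rfl rfl,
            by simp only [distLeft, if_neg hi]⟩
        · exact .inr ⟨.inr (.inl ⟨i', a, by omega⟩), adj_left rfl,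
            by simp only [distLeft, if_neg hi]; omega⟩
    · rcases a with _ | a
      · exact .inr ⟨.inl ⟨C, by omega⟩, adj_path_right rfl rfl, by simp only [distLeft]; omega⟩
      · exact .inr ⟨.inr (.inr ⟨i', a, by omega⟩), adj_right rfl, by simp only [distLeft]; omega⟩

theorem sum_dist_sub_self {j L : ℕ} (h : j ≤ L) :
    ∑ x : Fin L, (((j - x + (x - j) : ℕ) : ℤ) - x) = j * (j + 1 - L) := by
  rw [Fin.sum_univ_eq_sum_range (fun x : ℕ => ((j - x + (x - j) : ℕ) : ℤ) - x)]
  induction L, h using Nat.le_induction with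
  | base =>
    have hinit : ∀ l ≤ j, ∑ x ∈ Finset.range l, (((j - x + (x - j) : ℕ) : ℤ) - x)
        = l * (j + 1 - l) := by
      intro l hl
      induction l with
      | zero => simp
      | succ l ih =>
        rw [Finset.sum_range_succ, ih (by omega),
          show ((j - l + (l - j) : ℕ) : ℤ) = j - l by omega]
        push_cast
        ring
    exact hinit j le_rfl
  | succ L hL ih =>
    rw [Finset.sum_range_succ, ih, show ((j - L + (L - j) : ℕ) : ℤ) = L - j by omega]
    push_cast
    ring

theorem transmission_path (c : Fin (C + 1)) :
    (transmission (doubleStarlikeTree C k m A B) (.inl c) : ℤ)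
      - transmission (doubleStarlikeTree C k m A B) (.inl 0)
      = c * (c + (∑ i, A i : ℕ) - (∑ i, B i : ℕ) - C) := by
  have hc := c.isLt
  have hP := sum_dist_sub_self (j := c) (L := C + 1) (by omega)
  have hB : ∀ x : ℕ, ((C - c + x + 1 : ℕ) : ℤ) - ((C + x + 1 : ℕ) : ℤ) = -c := by omega
  have hA : ∀ x : ℕ, ((c + x + 1 : ℕ) : ℤ) - ((x + 1 : ℕ) : ℤ) = c := by omega
  simp only [transmission, dist_path]
  rw [Nat.cast_sum, Nat.cast_sum, ← Finset.sum_sub_distrib]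
  simp only [Fintype.sum_sum_type, distPath, Fintype.sum_sigma, Fin.val_zero, hA, hB,
    Nat.zero_sub, Nat.sub_zero, zero_add, hP]
  simp [← Finset.sum_mul]
  ring

theorem transmission_left (i : Fin k) (j : Fin (A i)) :
    (transmission (doubleStarlikeTree C k m A B) (.inr (.inl ⟨i, j⟩)) : ℤ)
      - transmission (doubleStarlikeTree C k m A B) (.inl 0)
      = (j + 1) * (1 + C + (∑ i, A i : ℕ) + (∑ i, B i : ℕ) - 2 * A i + j) := by
  have hj := j.isLt
  have hP := sum_dist_sub_self (j := j) (L := A i) (by omega)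
  have hA : ∀ i', ∑ x : Fin (A i'),
      (((if i' = i then (j - x) + (x - j) else j + x + 2 : ℕ) : ℤ) - (x + 1 : ℕ))
      = (j + 1) * A i' + if i' = i then (j + 1) * (j - 2 * A i : ℤ) else 0 := by
    intro i'
    split_ifs with hi
    · subst hi
      push_cast
      push_cast at hP
      simp only [← sub_sub, Finset.sum_sub_distrib] at hP ⊢
      rw [hP]
      simp
      ring
    · rw [Finset.sum_congr rfl (g := fun _ => (j + 1 : ℤ)) (by intros; push_cast; ring)]
      simp
      ring
  have hB : ∀ x : ℕ, ((j + C + x + 2 : ℕ) : ℤ) - ((C + x + 1 : ℕ) : ℤ) = j + 1 := by omega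
  have hP : ∀ x : ℕ, ((j + 1 + x : ℕ) : ℤ) - (x : ℤ) = j + 1 := by omega
  simp only [transmission, dist_path, dist_left]
  rw [Nat.cast_sum, Nat.cast_sum, ← Finset.sum_sub_distrib]
  simp only [Fintype.sum_sum_type, distPath, distLeft, Fintype.sum_sigma, Fin.val_zero,
    Nat.zero_sub, Nat.sub_zero, zero_add, hA, hB, hP, Finset.sum_add_distrib]
  simp [← Finset.sum_mul, ← Finset.mul_sum]
  ring

theorem not_transmissionIrregular_of_left (i : Fin k)
    (h : 1 + C + ∑ i, A i + ∑ i, B i ≤ 2 * A i) :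
    ¬ TransmissionIrregular (doubleStarlikeTree C k m A B) := by
  intro hTI
  have hle : A i ≤ ∑ i, A i := Finset.single_le_sum (f := A) (by simp) (Finset.mem_univ i)
  have ht := transmission_left (C := C) (A := A) (B := B) i
    ⟨2 * A i - (1 + C + ∑ i, A i + ∑ i, B i), by omega⟩
  rw [show ((1 : ℤ) + C + (∑ i, A i : ℕ) + (∑ i, B i : ℕ) - 2 * A i
    + (2 * A i - (1 + C + ∑ i, A i + ∑ i, B i) : ℕ)) = 0 by omega, mul_zero, sub_eq_zero] at ht
  simpa using hTI (Nat.cast_injective ht)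

/-- Exchanging the two ends of a double starlike tree. -/
def swapIso : doubleStarlikeTree C k m A B ≃g doubleStarlikeTree C m k B A where
  toEquiv := Equiv.sumCongr Fin.revPerm (Equiv.sumComm _ _)
  map_rel_iff' := by
    rintro (⟨a, ha⟩ | ⟨i, a, ha⟩ | ⟨i, a, ha⟩) (⟨b, hb⟩ | ⟨j, b, hb⟩ | ⟨j, b, hb⟩) <;>
    simp [doubleStarlikeTree, SimpleGraph.fromRel_adj, Fin.rev] <;> omega

end doubleStarlikeTree

/-- If some `A_i ≥ n/2`, or some `B_i ≥ n/2`, or `1 + A_* ≤ n/2`, where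
`n = 1 + C + A_* + B_*` is the order, then the double starlike tree
`DS(C; A; B)` is not transmission irregular. -/
theorem doubleStarlike_not_TI_of_bad_lengths (C k m : ℕ) (hC : 0 < C)
    (hk : 2 ≤ k) (hm : 2 ≤ m) (A : Fin k → ℕ) (B : Fin m → ℕ)
    (hA : ∀ i, 0 < A i) (hB : ∀ i, 0 < B i)
    (hAB : ∑ i, B i ≤ ∑ i, A i)
    (n : ℕ) (hn : n = 1 + C + (∑ i, A i) + ∑ i, B i)
    (h : (∃ i : Fin k, n ≤ 2 * A i) ∨ (∃ i : Fin m, n ≤ 2 * B i) ∨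
         2 * (1 + ∑ i, A i) ≤ n) :
    ¬ TransmissionIrregular (doubleStarlikeTree C k m A B) := by
  subst hn
  rcases h with ⟨i, hi⟩ | ⟨i, hi⟩ | h
  · exact doubleStarlikeTree.not_transmissionIrregular_of_left i (by omega)
  · intro hTI
    refine doubleStarlikeTree.not_transmissionIrregular_of_left (A := B) (B := A) (C := C) i
      (by omega) fun u v huv => ?_
    apply doubleStarlikeTree.swapIso.injective
    apply hTI
    simpa only [SimpleGraph.Iso.transmission_eq] using huv
  · intro hTI
    have ht := doubleStarlikeTree.transmission_path (A := A) (B := B)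
      (⟨C + ∑ i, B i - ∑ i, A i, by omega⟩ : Fin (C + 1))
    rw [show (((C + ∑ i, B i - ∑ i, A i : ℕ) : ℤ) + (∑ i, A i : ℕ) - (∑ i, B i : ℕ) - C) = 0 by
      omega, mul_zero, sub_eq_zero] at ht
    have := hTI (Nat.cast_injective ht)
    simp only [Sum.inl.injEq, Fin.ext_iff, Fin.val_zero] at this
    omega
end

section
/- Let C, A_1, ..., A_k, B_1, ..., B_m be positive integers with k, m ≥ 2, A_* = Σ A_i, B_* = Σ B_i, and n = 1 + C + A_* + B_*. Define α_{ij} = (n - 1 - A_i - A_j)(A_j - A_i), β_{ij} = (n - 1 - B_i - B_j)(B_j - B_i), γ_i = (n - 1 - A_i - A_*)(A_* - A_i), and δ_{ij} = (n - 1 - A_i - B_j)(B_j - A_i) + C·(A_* - B_*). Then the double starlike tree DS(C; A_1, ..., A_k; B_1, ..., B_m) is transmission irregular if and only if all of the following hold: (i) the A_i are mutually distinct and the B_i are mutually distinct; (ii) A_i < n/2 for all i, B_i < n/2 for all i, and 1 + A_* > n/2; (iii) for all 1 ≤ i < j ≤ k, α_{ij} has no positive divisor p > √|α_{ij}| with (a)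 p and α_{ij}/p of the same parity iff n is odd, (b) g(α_{ij}, n + 1 - 2A_i) ≤ p ≤ g(α_{ij}, n - 1), and (c) g(α_{ji}, n + 1 - 2A_j) ≤ p ≤ g(α_{ji}, n - 1); (iv) for all 1 ≤ i < j ≤ m, β_{ij} has no positive divisor p > √|β_{ij}| with (a) p and β_{ij}/p of the same parity iff n is odd, (b) g(β_{ij}, n + 1 - 2B_i) ≤ p ≤ g(β_{ij}, n - 1), and (c) g(β_{ji}, n + 1 - 2B_j) ≤ p ≤ g(β_{ji}, n - 1); (v) for all 1 ≤ i ≤ k, γ_i has no positive divisor p > √|γ_i| with (a) p and γ_i/p of the same parity iff n is odd, (b) g(γ_i, n + 1 - 2A_i) ≤ p ≤ g(γ_i, n - 1), and (c) g(-γ_i, 2A_* - n + 3) ≤ p ≤ g(-γ_i, 2A_* + 2C - n + 1); (vi) for all 1 ≤ i ≤ k and 1 ≤ j ≤ m, δ_{ij} has no positive divisor p > √|δ_{ij}| with (a) p and δ_{ij}/p of the same parity iff n is odd, (b) g(δ_{ij}, n + 1 - 2A_i) ≤ p ≤ g(δ_{ij}, n - 1), and (c) g(-δ_{ij}, n + 1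 - 2B_j) ≤ p ≤ g(-δ_{ij}, n - 1). -/
/-- The auxiliary function `g : ℝ × (0, ∞) → ℝ ∪ {-∞}`, with value
`(C₂ + √(C₂² - 4C₁))/2` when `C₂² - 4C₁ ≥ 0` and `-∞` otherwise. -/
noncomputable def gFun (c1 c2 : ℝ) : EReal :=
  if 0 ≤ c2 ^ 2 - 4 * c1 then ((c2 + Real.sqrt (c2 ^ 2 - 4 * c1)) / 2 : ℝ) else ⊥

lemma SimpleGraph.dist_eq_of_lipschitz_of_descent {V : Type*} (G : SimpleGraph V) (x : V)
    (f : V → ℕ) (h0 : f x = 0) (hlip : ∀ y z, G.Adj y z → f z ≤ f y + 1)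
    (hdesc : ∀ y, y ≠ x → ∃ z, G.Adj y z ∧ f z + 1 = f y) (y : V) :
    G.dist x y = f y := by
  have hwalk : ∀ l y, f y = l → ∃ w : G.Walk y x, w.length = l := by
    intro l
    induction l with
    | zero =>
      intro y hy
      by_cases hyx : y = x
      · subst hyx
        exact ⟨.nil, rfl⟩
      · obtain ⟨z, -, hz⟩ := hdesc y hyx
        omega
    | succ l ih =>
      intro y hy
      have hyx : y ≠ x := by
        rintro rfl
        omega
      obtain ⟨z, hadj, hz⟩ := hdesc y hyx
      obtain ⟨w, hw⟩ := ih z (by omega)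
      exact ⟨.cons hadj w, by simp [hw]⟩
  have hle : ∀ (a b : V) (w : G.Walk a b), f b ≤ f a + w.length := by
    intro a b w
    induction w with
    | nil => simp
    | cons h w ih =>
      have := hlip _ _ h
      rw [SimpleGraph.Walk.length_cons]
      omega
  obtain ⟨w, hw⟩ := hwalk _ y rfl
  apply le_antisymm
  · rw [SimpleGraph.dist_comm, ← hw]
    exact SimpleGraph.dist_le w
  · obtain ⟨w', hw'⟩ := (w.reverse.reachable).exists_walk_length_eq_dist
    have := hle _ _ w'
    omega

/-- The vertex type of `doubleStarlikeTree`. -/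
abbrev DSVertex (C k m : ℕ) (A : Fin k → ℕ) (B : Fin m → ℕ) : Type :=
  Fin (C + 1) ⊕ ((i : Fin k) × Fin (A i)) ⊕ ((i : Fin m) × Fin (B i))

/-- An explicit formula for the distance in `doubleStarlikeTree`. -/
def dsDist {C k m : ℕ} {A : Fin k → ℕ} {B : Fin m → ℕ} :
    DSVertex C k m A B → DSVertex C k m A B → ℕ
  | .inl c, .inl c' => (c.val - c'.val) + (c'.val - c.val)
  | .inl c, .inr (.inl ⟨_, j⟩) => c.val + (j.val + 1)
  | .inl c, .inr (.inr ⟨_, j⟩) => (C - c.val) + (j.val + 1)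
  | .inr (.inl ⟨_, j⟩), .inl c => c.val + (j.val + 1)
  | .inr (.inl ⟨i, j⟩), .inr (.inl ⟨i', j'⟩) =>
    if i = i' then (j.val - j'.val) + (j'.val - j.val) else (j.val + 1) + (j'.val + 1)
  | .inr (.inl ⟨_, j⟩), .inr (.inr ⟨_, j'⟩) => C + (j.val + 1) + (j'.val + 1)
  | .inr (.inr ⟨_, j⟩), .inl c => (C - c.val) + (j.val + 1)
  | .inr (.inr ⟨_, j⟩), .inr (.inl ⟨_, j'⟩) => C + (j.val + 1) + (j'.val + 1)
  | .inr (.inr ⟨i, j⟩), .inr (.inr ⟨i', j'⟩) =>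
    if i = i' then (j.val - j'.val) + (j'.val - j.val) else (j.val + 1) + (j'.val + 1)

section Distance

variable {C k m : ℕ} {A : Fin k → ℕ} {B : Fin m → ℕ}

lemma dsDist_self (x : DSVertex C k m A B) : dsDist x x = 0 := by
  rcases x with c | ⟨i, j⟩ | ⟨i, j⟩ <;> simp [dsDist]

lemma doubleStarlikeTree_adj_inner {c c' : Fin (C + 1)} (h : c.val + 1 = c'.val) :
    (doubleStarlikeTree C k m A B).Adj (.inl c) (.inl c') := by
  refine ⟨?_, Or.inl h⟩
  simp only [ne_eq, Sum.inl.injEq, Fin.ext_iff]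
  omega

lemma doubleStarlikeTree_adj_innerA {c : Fin (C + 1)} {i : Fin k} {j : Fin (A i)}
    (hc : c.val = 0) (hj : j.val = 0) :
    (doubleStarlikeTree C k m A B).Adj (.inl c) (.inr (.inl ⟨i, j⟩)) :=
  ⟨by simp, Or.inl ⟨hc, hj⟩⟩

lemma doubleStarlikeTree_adj_innerB {c : Fin (C + 1)} {i : Fin m} {j : Fin (B i)}
    (hc : c.val = C) (hj : j.val = 0) :
    (doubleStarlikeTree C k m A B).Adj (.inl c) (.inr (.inr ⟨i, j⟩)) :=
  ⟨by simp, Or.inl ⟨hc, hj⟩⟩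

lemma doubleStarlikeTree_adj_A {i : Fin k} {j j' : Fin (A i)} (h : j.val + 1 = j'.val) :
    (doubleStarlikeTree C k m A B).Adj (.inr (.inl ⟨i, j⟩)) (.inr (.inl ⟨i, j'⟩)) := by
  refine ⟨?_, Or.inl ⟨rfl, h⟩⟩
  simp only [ne_eq, Sum.inr.injEq, Sum.inl.injEq, Sigma.mk.injEq, heq_eq_eq, true_and, Fin.ext_iff]
  omega

lemma doubleStarlikeTree_adj_B {i : Fin m} {j j' : Fin (B i)} (h : j.val + 1 = j'.val) :
    (doubleStarlikeTree C k m A B).Adj (.inr (.inr ⟨i, j⟩)) (.inr (.inr ⟨i, j'⟩)) := by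
  refine ⟨?_, Or.inl ⟨rfl, h⟩⟩
  simp only [ne_eq, Sum.inr.injEq, Sigma.mk.injEq, heq_eq_eq, true_and, Fin.ext_iff]
  omega

lemma dsDist_le_of_adj (x y z : DSVertex C k m A B)
    (h : (doubleStarlikeTree C k m A B).Adj y z) : dsDist x z ≤ dsDist x y + 1 := by
  obtain ⟨-, h⟩ := h
  rcases y with c | ⟨i, j⟩ | ⟨i, j⟩ <;> rcases z with c' | ⟨i', j'⟩ | ⟨i', j'⟩ <;>
    simp only [or_self, or_false, false_or, ← Fin.ext_iff] at h <;>
    rcases x with d | ⟨l, r⟩ | ⟨l, r⟩ <;> simp only [dsDist] <;>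
    (try have := d.isLt) <;> (try have := c.isLt) <;> (try have := c'.isLt) <;>
    grind

lemma exists_adj_dsDist_succ_eq (x y : DSVertex C k m A B) (hxy : y ≠ x) :
    ∃ z, (doubleStarlikeTree C k m A B).Adj y z ∧ dsDist x z + 1 = dsDist x y := by
  have downA : ∀ (i : Fin k) (j : Fin (A i)), ∃ z : DSVertex C k m A B,
      (doubleStarlikeTree C k m A B).Adj (.inr (.inl ⟨i, j⟩)) z ∧
      ((j.val = 0 ∧ z = .inl 0) ∨
        ∃ j' : Fin (A i), j'.val + 1 = j.val ∧ z = .inr (.inl ⟨i, j'⟩)) := by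
    intro i j
    by_cases hj : j.val = 0
    · exact ⟨_, (doubleStarlikeTree_adj_innerA (c := 0) rfl hj).symm, .inl ⟨hj, rfl⟩⟩
    · have hj' : (j.val - 1) + 1 = j.val := by omega
      exact ⟨_, (doubleStarlikeTree_adj_A (j := ⟨j.val - 1, by omega⟩) hj').symm,
        .inr ⟨_, hj', rfl⟩⟩
  have downB : ∀ (i : Fin m) (j : Fin (B i)), ∃ z : DSVertex C k m A B,
      (doubleStarlikeTree C k m A B).Adj (.inr (.inr ⟨i, j⟩)) z ∧
      ((j.val = 0 ∧ z = .inl (Fin.last C)) ∨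
        ∃ j' : Fin (B i), j'.val + 1 = j.val ∧ z = .inr (.inr ⟨i, j'⟩)) := by
    intro i j
    by_cases hj : j.val = 0
    · exact ⟨_, (doubleStarlikeTree_adj_innerB (c := Fin.last C) rfl hj).symm, .inl ⟨hj, rfl⟩⟩
    · have hj' : (j.val - 1) + 1 = j.val := by omega
      exact ⟨_, (doubleStarlikeTree_adj_B (j := ⟨j.val - 1, by omega⟩) hj').symm,
        .inr ⟨_, hj', rfl⟩⟩
  have innerDown : ∀ c : Fin (C + 1), 0 < c.val → ∃ c' : Fin (C + 1), c'.val + 1 = c.val ∧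
      (doubleStarlikeTree C k m A B).Adj (.inl c) (.inl c') := by
    intro c hc
    have h : (c.val - 1) + 1 = c.val := by omega
    exact ⟨⟨c.val - 1, by omega⟩, h, (doubleStarlikeTree_adj_inner h).symm⟩
  have innerUp : ∀ c : Fin (C + 1), c.val < C → ∃ c' : Fin (C + 1), c'.val = c.val + 1 ∧
      (doubleStarlikeTree C k m A B).Adj (.inl c) (.inl c') := by
    intro c hc
    exact ⟨⟨c.val + 1, by omega⟩, rfl, doubleStarlikeTree_adj_inner rfl⟩
  rcases x with c | ⟨i, j⟩ | ⟨i, j⟩ <;> rcases y with c' | ⟨i', j'⟩ | ⟨i', j'⟩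
  · rcases lt_trichotomy c.val c'.val with h | h | h
    · obtain ⟨d, hd, hadj⟩ := innerDown c' (by omega)
      exact ⟨_, hadj, by simp only [dsDist]; omega⟩
    · exact absurd (congrArg Sum.inl (Fin.ext h.symm)) hxy
    · obtain ⟨d, hd, hadj⟩ := innerUp c' (by omega)
      exact ⟨_, hadj, by simp only [dsDist]; omega⟩
  · obtain ⟨z, hadj, ⟨hj, rfl⟩ | ⟨r, hr, rfl⟩⟩ := downA i' j'
    · exact ⟨_, hadj, by simp [dsDist, hj]⟩
    · exact ⟨_, hadj, by simp only [dsDist]; omega⟩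
  · obtain ⟨z, hadj, ⟨hj, rfl⟩ | ⟨r, hr, rfl⟩⟩ := downB i' j'
    · exact ⟨_, hadj, by simp only [dsDist, Fin.val_last]; omega⟩
    · exact ⟨_, hadj, by simp only [dsDist]; omega⟩
  · by_cases h : c'.val = 0
    · refine ⟨_, doubleStarlikeTree_adj_innerA (i := i) (j := ⟨0, j.pos⟩) h rfl, ?_⟩
      simp [dsDist, h]
    · obtain ⟨d, hd, hadj⟩ := innerDown c' (by omega)
      exact ⟨_, hadj, by simp only [dsDist]; omega⟩
  · by_cases hi : i = i'
    · subst hi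
      rcases lt_trichotomy j.val j'.val with h | h | h
      · obtain ⟨z, hadj, ⟨hj, rfl⟩ | ⟨r, hr, rfl⟩⟩ := downA i j'
        · omega
        · exact ⟨_, hadj, by simp only [dsDist, if_true]; omega⟩
      · rw [Fin.ext h] at hxy
        exact absurd rfl hxy
      · refine ⟨_, doubleStarlikeTree_adj_A (j' := ⟨j'.val + 1, by omega⟩) rfl, ?_⟩
        simp only [dsDist, if_true]
        omega
    · obtain ⟨z, hadj, ⟨hj, rfl⟩ | ⟨r, hr, rfl⟩⟩ := downA i' j'
      · exact ⟨_, hadj, by simp [dsDist, hi, hj]⟩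
      · exact ⟨_, hadj, by simp only [dsDist, if_neg hi]; omega⟩
  · obtain ⟨z, hadj, ⟨hj, rfl⟩ | ⟨r, hr, rfl⟩⟩ := downB i' j'
    · exact ⟨_, hadj, by simp only [dsDist, Fin.val_last]; omega⟩
    · exact ⟨_, hadj, by simp only [dsDist]; omega⟩
  · by_cases h : c'.val = C
    · refine ⟨_, doubleStarlikeTree_adj_innerB (i := i) (j := ⟨0, j.pos⟩) h rfl, ?_⟩
      simp [dsDist, h]
    · obtain ⟨d, hd, hadj⟩ := innerUp c' (by omega)
      exact ⟨_, hadj, by simp only [dsDist]; omega⟩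
  · obtain ⟨z, hadj, ⟨hj, rfl⟩ | ⟨r, hr, rfl⟩⟩ := downA i' j'
    · exact ⟨_, hadj, by simp only [dsDist, Fin.val_zero]; omega⟩
    · exact ⟨_, hadj, by simp only [dsDist]; omega⟩
  · by_cases hi : i = i'
    · subst hi
      rcases lt_trichotomy j.val j'.val with h | h | h
      · obtain ⟨z, hadj, ⟨hj, rfl⟩ | ⟨r, hr, rfl⟩⟩ := downB i j'
        · omega
        · exact ⟨_, hadj, by simp only [dsDist, if_true]; omega⟩
      · rw [Fin.ext h] at hxy
        exact absurd rfl hxy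
      · refine ⟨_, doubleStarlikeTree_adj_B (j' := ⟨j'.val + 1, by omega⟩) rfl, ?_⟩
        simp only [dsDist, if_true]
        omega
    · obtain ⟨z, hadj, ⟨hj, rfl⟩ | ⟨r, hr, rfl⟩⟩ := downB i' j'
      · exact ⟨_, hadj, by simp only [dsDist, if_neg hi, Fin.val_last]; omega⟩
      · exact ⟨_, hadj, by simp only [dsDist, if_neg hi]; omega⟩

lemma doubleStarlikeTree_dist (x y : DSVertex C k m A B) :
    (doubleStarlikeTree C k m A B).dist x y = dsDist x y :=
  SimpleGraph.dist_eq_of_lipschitz_of_descent _ x _ (dsDist_self x)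
    (fun y z h => dsDist_le_of_adj x y z h) (exists_adj_dsDist_succ_eq x) y

end Distance

lemma sum_range_abs_sub_of_le (s : ℤ) (b : ℕ) (h : (b : ℤ) ≤ s) :
    ∑ j ∈ Finset.range b, (|s - ((j : ℤ) + 1)| - ((j : ℤ) + 1)) = b * s - b * (b + 1) := by
  induction b with
  | zero => simp
  | succ b ih =>
    push_cast at h
    rw [Finset.sum_range_succ, ih (by omega), abs_of_nonneg (by omega)]
    push_cast
    ring

lemma sum_range_abs_sub (s a : ℕ) (h : s ≤ a) :
    ∑ j ∈ Finset.range a, (|(s : ℤ) - ((j : ℤ) + 1)| - ((j : ℤ) + 1)) = s * s - s - s * a := by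
  induction a, h using Nat.le_induction with
  | base =>
    rw [sum_range_abs_sub_of_le _ _ le_rfl]
    ring
  | succ b hb ih =>
    rw [Finset.sum_range_succ, ih, abs_of_nonpos (by omega)]
    push_cast
    ring

/-- The difference between the transmission of a vertex of the double starlike tree and the
transmission of the end `Sum.inl 0` of its internal path. -/
def dsExcess {C k m : ℕ} {A : Fin k → ℕ} {B : Fin m → ℕ} : DSVertex C k m A B → ℤ
  | .inl c => (c.val : ℤ) * (c.val + (∑ l, (A l : ℤ) - ∑ l, (B l : ℤ) - C))
  | .inr (.inl ⟨i, j⟩) => ((j.val : ℤ) + 1) *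
      ((j.val + 1) + (C + ∑ l, (A l : ℤ) + ∑ l, (B l : ℤ) - 2 * A i))
  | .inr (.inr ⟨i, j⟩) => ((j.val : ℤ) + 1) *
      ((j.val + 1) + (C + ∑ l, (A l : ℤ) + ∑ l, (B l : ℤ) - 2 * B i)) +
      C * (∑ l, (A l : ℤ) - ∑ l, (B l : ℤ))

section Transmission

variable {C k m : ℕ} {A : Fin k → ℕ} {B : Fin m → ℕ}

lemma sum_ite_pendent {ι : Type*} [Fintype ι] [DecidableEq ι] (a : ι → ℕ) (i : ι)
    (j : Fin (a i)) (e : ℤ) :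
    ∑ l, ∑ r : Fin (a l), ((((if i = l then (j.val - r.val) + (r.val - j.val)
      else (j.val + 1) + (r.val + 1) : ℕ) : ℤ)) - (e + (r.val + 1))) =
    (j.val + 1) * ((j.val + 1) + (∑ l, (a l : ℤ)) - 2 * a i - 1) - e * ∑ l, (a l : ℤ) := by
  have hown : ∑ r : Fin (a i), (|((j.val + 1 : ℕ) : ℤ) - ((r.val : ℤ) + 1)| - ((r.val : ℤ) + 1)) =
      ((j.val + 1 : ℕ) : ℤ) * ((j.val + 1 : ℕ) : ℤ) - ((j.val + 1 : ℕ) : ℤ)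
        - ((j.val + 1 : ℕ) : ℤ) * a i := by
    rw [← sum_range_abs_sub (j.val + 1) (a i) j.isLt]
    exact Fin.sum_univ_eq_sum_range
      (fun r => |((j.val + 1 : ℕ) : ℤ) - ((r : ℤ) + 1)| - ((r : ℤ) + 1)) (a i)
  have hterm : ∀ l, ∑ r : Fin (a l), ((((if i = l then (j.val - r.val) + (r.val - j.val)
      else (j.val + 1) + (r.val + 1) : ℕ) : ℤ)) - (e + (r.val + 1))) =
      ((j.val + 1) - e) * a l + if i = l then
        (((j.val + 1) * (j.val + 1) - (j.val + 1) - (j.val + 1) * a i) -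
          (j.val + 1) * a i : ℤ) else 0 := by
    intro l
    by_cases hl : i = l
    · subst hl
      have : ∀ r : Fin (a i), ((((if i = i then (j.val - r.val) + (r.val - j.val)
          else (j.val + 1) + (r.val + 1) : ℕ) : ℤ)) - (e + (r.val + 1))) =
          (|((j.val + 1 : ℕ) : ℤ) - ((r.val : ℤ) + 1)| - ((r.val : ℤ) + 1)) - e := by
        intro r
        rw [if_pos rfl]
        rcases le_total j.val r.val with h | h
        · rw [abs_of_nonpos (by omega)]
          omega
        · rw [abs_of_nonneg (by omega)]
          omega
      rw [Finset.sum_congr rfl (fun r _ => this r), Finset.sum_sub_distrib, hown]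
      simp
      ring
    · have : ∀ r : Fin (a l), ((((if i = l then (j.val - r.val) + (r.val - j.val)
          else (j.val + 1) + (r.val + 1) : ℕ) : ℤ)) - (e + (r.val + 1))) = (j.val + 1) - e := by
        intro r
        rw [if_neg hl]
        push_cast
        ring
      rw [Finset.sum_congr rfl (fun r _ => this r), if_neg hl]
      simp
      ring
  rw [Finset.sum_congr rfl (fun l _ => hterm l), Finset.sum_add_distrib, ← Finset.mul_sum]
  simp
  ring

lemma transmission_sub_eq_dsExcess (x : DSVertex C k m A B) :
    (transmission (doubleStarlikeTree C k m A B) x : ℤ) -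
      transmission (doubleStarlikeTree C k m A B) (.inl 0) = dsExcess x := by
  simp only [transmission, doubleStarlikeTree_dist]
  push_cast
  rw [← Finset.sum_sub_distrib, Fintype.sum_sum_type, Fintype.sum_sum_type, Fintype.sum_sigma,
    Fintype.sum_sigma]
  rcases x with c | ⟨i, j⟩ | ⟨i, j⟩
  · have h1 : ∑ d : Fin (C + 1), ((dsDist (.inl c : DSVertex C k m A B) (.inl d) : ℤ) -
        dsDist (.inl 0 : DSVertex C k m A B) (.inl d)) = c.val * c.val - c.val * C := by
      have : ∀ d : Fin (C + 1), ((dsDist (.inl c : DSVertex C k m A B) (.inl d) : ℤ) -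
          dsDist (.inl 0 : DSVertex C k m A B) (.inl d)) = |(c.val : ℤ) - d.val| - d.val := by
        intro d
        simp only [dsDist, Fin.val_zero]
        rcases le_total c.val d.val with h | h
        · rw [abs_of_nonpos (by omega)]
          omega
        · rw [abs_of_nonneg (by omega)]
          omega
      rw [Finset.sum_congr rfl (fun d _ => this d), Fin.sum_univ_succ]
      have h := Fin.sum_univ_eq_sum_range
        (fun r => |(c.val : ℤ) - ((r : ℤ) + 1)| - ((r : ℤ) + 1)) C
      simp only [Fin.val_succ, Fin.val_zero]
      push_cast
      rw [h, sum_range_abs_sub _ _ (by omega)]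
      simp
      ring
    have h2 : ∀ (l : Fin k) (r : Fin (A l)), ((dsDist (.inl c : DSVertex C k m A B)
        (.inr (.inl ⟨l, r⟩)) : ℤ) - dsDist (.inl 0 : DSVertex C k m A B) (.inr (.inl ⟨l, r⟩))) =
        c.val := by
      intro l r
      simp [dsDist]
    have h3 : ∀ (l : Fin m) (r : Fin (B l)), ((dsDist (.inl c : DSVertex C k m A B)
        (.inr (.inr ⟨l, r⟩)) : ℤ) - dsDist (.inl 0 : DSVertex C k m A B) (.inr (.inr ⟨l, r⟩))) =
        -c.val := by
      intro l r
      simp only [dsDist, Fin.val_zero]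
      omega
    simp only [h1, h2, h3, dsExcess, Finset.sum_const, Finset.card_univ, Fintype.card_fin,
      nsmul_eq_mul, ← Finset.sum_mul]
    ring
  · have h1 : ∀ d : Fin (C + 1), ((dsDist (.inr (.inl ⟨i, j⟩) : DSVertex C k m A B) (.inl d) : ℤ) -
        dsDist (.inl 0 : DSVertex C k m A B) (.inl d)) = j.val + 1 := by
      intro d
      simp [dsDist]
    have h2 := sum_ite_pendent A i j 0
    have h3 : ∀ (l : Fin m) (r : Fin (B l)), ((dsDist (.inr (.inl ⟨i, j⟩) : DSVertex C k m A B)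
        (.inr (.inr ⟨l, r⟩)) : ℤ) - dsDist (.inl 0 : DSVertex C k m A B) (.inr (.inr ⟨l, r⟩))) =
        j.val + 1 := by
      intro l r
      simp only [dsDist, Fin.val_zero]
      omega
    have h2' : ∑ l, ∑ r : Fin (A l), ((dsDist (.inr (.inl ⟨i, j⟩) : DSVertex C k m A B)
        (.inr (.inl ⟨l, r⟩)) : ℤ) - dsDist (.inl 0 : DSVertex C k m A B) (.inr (.inl ⟨l, r⟩))) =
        (j.val + 1) * ((j.val + 1) + (∑ l, (A l : ℤ)) - 2 * A i - 1) -
          0 * ∑ l, (A l : ℤ) := by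
      rw [← h2]
      refine Finset.sum_congr rfl fun l _ => Finset.sum_congr rfl fun r _ => ?_
      simp only [dsDist, Fin.val_zero]
      push_cast
      ring
    simp only [h1, h2', h3, dsExcess, Finset.sum_const, Finset.card_univ, Fintype.card_fin,
      nsmul_eq_mul, ← Finset.sum_mul]
    push_cast
    ring
  · have h1 : ∑ d : Fin (C + 1), ((dsDist (.inr (.inr ⟨i, j⟩) : DSVertex C k m A B) (.inl d) : ℤ) -
        dsDist (.inl 0 : DSVertex C k m A B) (.inl d)) = (C + 1) * (j.val + 1) := by
      have : ∀ d : Fin (C + 1), ((dsDist (.inr (.inr ⟨i, j⟩) : DSVertex C k m A B) (.inl d) : ℤ) -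
          dsDist (.inl 0 : DSVertex C k m A B) (.inl d)) =
          ((j.val + 1) + ((d.rev).val : ℤ)) - d.val := by
        intro d
        simp only [dsDist, Fin.val_zero, Fin.val_rev]
        omega
      have hrev : ∑ d : Fin (C + 1), ((d.rev).val : ℤ) = ∑ d : Fin (C + 1), (d.val : ℤ) :=
        Equiv.sum_comp Fin.revPerm (fun d : Fin (C + 1) => (d.val : ℤ))
      rw [Finset.sum_congr rfl (fun d _ => this d), Finset.sum_sub_distrib, Finset.sum_add_distrib,
        hrev]
      simp
    have h2 : ∀ (l : Fin k) (r : Fin (A l)), ((dsDist (.inr (.inr ⟨i, j⟩) : DSVertex C k m A B)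
        (.inr (.inl ⟨l, r⟩)) : ℤ) - dsDist (.inl 0 : DSVertex C k m A B) (.inr (.inl ⟨l, r⟩))) =
        C + (j.val + 1) := by
      intro l r
      simp only [dsDist, Fin.val_zero]
      omega
    have h3 := sum_ite_pendent B i j C
    have h3' : ∑ l, ∑ r : Fin (B l), ((dsDist (.inr (.inr ⟨i, j⟩) : DSVertex C k m A B)
        (.inr (.inr ⟨l, r⟩)) : ℤ) - dsDist (.inl 0 : DSVertex C k m A B) (.inr (.inr ⟨l, r⟩))) =
        (j.val + 1) * ((j.val + 1) + (∑ l, (B l : ℤ)) - 2 * B i - 1) -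
          C * ∑ l, (B l : ℤ) := by
      rw [← h3]
      refine Finset.sum_congr rfl fun l _ => Finset.sum_congr rfl fun r _ => ?_
      simp only [dsDist, Fin.val_zero, Nat.sub_zero]
      push_cast
      ring
    simp only [h1, h2, h3', dsExcess, Finset.sum_const, Finset.card_univ, Fintype.card_fin,
      nsmul_eq_mul, ← Finset.sum_mul]
    ring

lemma transmissionIrregular_iff_dsExcess_injective :
    TransmissionIrregular (doubleStarlikeTree C k m A B) ↔
      Function.Injective (dsExcess : DSVertex C k m A B → ℤ) := by
  have key : ∀ x y : DSVertex C k m A B,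
      transmission (doubleStarlikeTree C k m A B) x =
        transmission (doubleStarlikeTree C k m A B) y ↔ dsExcess x = dsExcess y := by
    intro x y
    have hx := transmission_sub_eq_dsExcess x
    have hy := transmission_sub_eq_dsExcess y
    omega
  exact ⟨fun h x y hxy => h ((key x y).2 hxy), fun h x y hxy => h ((key x y).1 hxy)⟩

end Transmission

lemma gFun_le_iff {c₁ c₂ p : ℝ} (hp : 0 < p) (h : |c₁| < p ^ 2) :
    gFun c₁ c₂ ≤ (p : EReal) ↔ c₂ * p ≤ p ^ 2 + c₁ := by
  unfold gFun
  obtain ⟨h1, h2⟩ := abs_lt.1 h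
  split_ifs with hd
  · rw [EReal.coe_le_coe_iff]
    have hs := Real.sq_sqrt hd
    have hs0 := Real.sqrt_nonneg (c₂ ^ 2 - 4 * c₁)
    set s := Real.sqrt (c₂ ^ 2 - 4 * c₁)
    constructor
    · intro hle
      nlinarith
    · intro hle
      by_contra! hlt
      have : 0 < 2 * p - c₂ + s := by
        by_contra! hneg
        nlinarith
      nlinarith
  · simp only [bot_le, true_iff]
    nlinarith [sq_nonneg (2 * p - c₂)]

lemma le_gFun_iff {c₁ c₂ p : ℝ} (hp : 0 < p) (h : |c₁| < p ^ 2) :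
    (p : EReal) ≤ gFun c₁ c₂ ↔ p ^ 2 + c₁ ≤ c₂ * p := by
  unfold gFun
  obtain ⟨h1, h2⟩ := abs_lt.1 h
  split_ifs with hd
  · rw [EReal.coe_le_coe_iff]
    have hs := Real.sq_sqrt hd
    have hs0 := Real.sqrt_nonneg (c₂ ^ 2 - 4 * c₁)
    set s := Real.sqrt (c₂ ^ 2 - 4 * c₁)
    constructor
    · intro hle
      have : 0 < 2 * p - c₂ + s := by
        by_contra! hneg
        nlinarith
      nlinarith
    · intro hle
      by_contra! hlt
      nlinarith
  · simp only [le_bot_iff, EReal.coe_ne_bot, false_iff, not_le]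
    nlinarith [sq_nonneg (2 * p - c₂)]

/-- Divisors `p` of `α` in the range cut out by `gFun` correspond to coincidences between the
values of `s ↦ s * (s + u)` on `[1, a]` and those of `t ↦ t * (t + w) + e` on `[1, b]`. -/
lemma exists_divisor_iff_exists_eq (n : ℕ) (α u w e a b : ℤ) {l₁ r₁ l₂ r₂ α' : ℝ}
    (hu : 0 < 2 + u) (hw : 0 < 2 + w)
    (hnu : 2 ∣ (n : ℤ) - 1 - u) (hnw : 2 ∣ (n : ℤ) - 1 - w)
    (hα : 4 * α = u ^ 2 - w ^ 2 + 4 * e)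
    (hl₁ : l₁ = 2 + u) (hr₁ : r₁ = 2 * a + u) (hl₂ : l₂ = 2 + w) (hr₂ : r₂ = 2 * b + w)
    (hα' : α' = -α) :
    (∃ p : ℤ, 0 < p ∧ p ∣ α ∧ Real.sqrt |(α : ℝ)| < (p : ℝ) ∧
      ((p ≡ α / p [ZMOD 2]) ↔ Odd n) ∧
      (gFun (α : ℝ) l₁ ≤ ((p : ℝ) : EReal) ∧ ((p : ℝ) : EReal) ≤ gFun (α : ℝ) r₁) ∧
      (gFun α' l₂ ≤ ((p : ℝ) : EReal) ∧ ((p : ℝ) : EReal) ≤ gFun α' r₂)) ↔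
    ∃ s t : ℤ, (1 ≤ s ∧ s ≤ a) ∧ (1 ≤ t ∧ t ≤ b) ∧ s * (s + u) = t * (t + w) + e := by
  have hrange : ∀ p q : ℤ, 0 < p → α = p * q → Real.sqrt |(α : ℝ)| < (p : ℝ) →
      ((gFun (α : ℝ) l₁ ≤ ((p : ℝ) : EReal) ∧ ((p : ℝ) : EReal) ≤ gFun (α : ℝ) r₁) ∧
      (gFun α' l₂ ≤ ((p : ℝ) : EReal) ∧ ((p : ℝ) : EReal) ≤ gFun α' r₂) ↔
      (2 + u ≤ p + q ∧ p + q ≤ 2 * a + u) ∧ (2 + w ≤ p - q ∧ p - q ≤ 2 * b + w)) := by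
    intro p q hp hpq hlt
    have hp' : (0 : ℝ) < p := by exact_mod_cast hp
    have habs : |(α : ℝ)| < (p : ℝ) ^ 2 := (Real.sqrt_lt' hp').1 hlt
    have habs' : |α'| < (p : ℝ) ^ 2 := by rwa [hα', abs_neg]
    have e1 : (p : ℝ) ^ 2 + α = (p + q) * p := by
      rw [hpq]
      push_cast
      ring
    have e2 : (p : ℝ) ^ 2 + α' = (p - q) * p := by
      rw [hα', hpq]
      push_cast
      ring
    rw [gFun_le_iff hp' habs, le_gFun_iff hp' habs, gFun_le_iff hp' habs',
      le_gFun_iff hp' habs', e1, e2, mul_le_mul_iff_left₀ hp', mul_le_mul_iff_left₀ hp',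
      mul_le_mul_iff_left₀ hp', mul_le_mul_iff_left₀ hp', hl₁, hr₁, hl₂, hr₂]
    norm_cast
  have hparity : ∀ p q : ℤ, (p ≡ q [ZMOD 2] ↔ Odd n) ↔ 2 ∣ (n : ℤ) - 1 - (p + q) := by
    intro p q
    rw [Nat.odd_iff, Int.ModEq]
    omega
  constructor
  · rintro ⟨p, hp, ⟨q, hq⟩, hlt, hpar, hg⟩
    have hdiv : α / p = q := by
      rw [hq, Int.mul_ediv_cancel_left _ hp.ne']
    rw [hdiv, hparity] at hpar
    obtain ⟨⟨g1, g2⟩, g3, g4⟩ := (hrange p q hp hq hlt).1 hg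
    obtain ⟨s, hs⟩ : 2 ∣ p + q - u := by omega
    obtain ⟨t, ht⟩ : 2 ∣ p - q - w := by omega
    refine ⟨s, t, by omega, by omega, ?_⟩
    have hs' : p + q = 2 * s + u := by omega
    have ht' : p - q = 2 * t + w := by omega
    have : (p + q) ^ 2 - (p - q) ^ 2 = 4 * α := by
      rw [hq]
      ring
    rw [hs', ht'] at this
    linarith
  · rintro ⟨s, t, ⟨hs1, hs2⟩, ⟨ht1, ht2⟩, heq⟩
    obtain ⟨p, hp⟩ : 2 ∣ (2 * s + u) + (2 * t + w) := by omega
    obtain ⟨q, hq⟩ : 2 ∣ (2 * s + u) - (2 * t + w) := by omega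
    have hp0 : 0 < p := by omega
    have hpq : α = p * q := by
      have : 4 * (p * q) = (2 * p) * (2 * q) := by ring
      rw [← hp, ← hq] at this
      linarith
    have hlt : Real.sqrt |(α : ℝ)| < (p : ℝ) := by
      rw [Real.sqrt_lt' (by exact_mod_cast hp0)]
      have : |α| < p ^ 2 := by
        rw [hpq, abs_mul, abs_of_pos hp0, sq]
        exact mul_lt_mul_of_pos_left (abs_lt.2 (by omega)) hp0
      exact_mod_cast this
    refine ⟨p, hp0, ⟨q, hpq⟩, hlt, ?_, (hrange p q hp0 hpq hlt).2 (by omega)⟩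
    rw [hpq, Int.mul_ediv_cancel_left _ hp0.ne', hparity]
    omega

/-- Injectivity of `dsExcess`, expressed through coincidences of values of explicit quadratics. -/
lemma dsExcess_injective_iff {C k m : ℕ} {A : Fin k → ℕ} {B : Fin m → ℕ}
    (hA : ∀ i, 0 < A i) (hB : ∀ i, 0 < B i) (hAB : ∑ i, B i ≤ ∑ i, A i)
    (n : ℕ) (hn : n = 1 + C + (∑ i, A i) + ∑ i, B i) :
    Function.Injective (dsExcess : DSVertex C k m A B → ℤ) ↔
      (Function.Injective A ∧ Function.Injective B ∧
       (∀ i, 2 * A i < n) ∧ (∀ i, 2 * B i < n) ∧ n < 2 * (1 + ∑ i, A i) ∧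
       (∀ i j : Fin k, i < j → ¬ ∃ s t : ℤ, (1 ≤ s ∧ s ≤ A i) ∧ (1 ≤ t ∧ t ≤ A j) ∧
          s * (s + ((n : ℤ) - 1 - 2 * A i)) = t * (t + ((n : ℤ) - 1 - 2 * A j)) + 0) ∧
       (∀ i j : Fin m, i < j → ¬ ∃ s t : ℤ, (1 ≤ s ∧ s ≤ B i) ∧ (1 ≤ t ∧ t ≤ B j) ∧
          s * (s + ((n : ℤ) - 1 - 2 * B i)) = t * (t + ((n : ℤ) - 1 - 2 * B j)) + 0) ∧
       (∀ i : Fin k, ¬ ∃ s t : ℤ, (1 ≤ s ∧ s ≤ A i) ∧ (1 ≤ t ∧ t ≤ C) ∧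
          s * (s + ((n : ℤ) - 1 - 2 * A i)) =
            t * (t + (2 * ∑ l, (A l : ℤ) - (n : ℤ) + 1)) + 0) ∧
       (∀ (i : Fin k) (j : Fin m), ¬ ∃ s t : ℤ, (1 ≤ s ∧ s ≤ A i) ∧ (1 ≤ t ∧ t ≤ B j) ∧
          s * (s + ((n : ℤ) - 1 - 2 * A i)) = t * (t + ((n : ℤ) - 1 - 2 * B j)) +
            C * (∑ l, (A l : ℤ) - ∑ l, (B l : ℤ)))) := by
  have hcA : ((∑ i, A i : ℕ) : ℤ) = ∑ l, (A l : ℤ) := by push_cast; rfl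
  have hcB : ((∑ i, B i : ℕ) : ℤ) = ∑ l, (B l : ℤ) := by push_cast; rfl
  set a : ℤ := ∑ l, (A l : ℤ) with ha
  set b : ℤ := ∑ l, (B l : ℤ) with hb
  have hn' : (n : ℤ) = 1 + C + a + b := by
    rw [hn, ← hcA, ← hcB]
    push_cast
    rfl
  have hab : b ≤ a := by
    rw [← hcA, ← hcB]
    exact_mod_cast hAB
  have hna : n < 2 * (1 + ∑ i, A i) ↔ (n : ℤ) < 2 * (1 + a) := by
    rw [← hcA]
    norm_cast
  rw [hna]
  have valI : ∀ c : Fin (C + 1), dsExcess (.inl c : DSVertex C k m A B) =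
      (c.val : ℤ) * (c.val + (2 * a - n + 1)) := by
    intro c
    rw [dsExcess, ← ha, ← hb, hn']
    ring
  have valA : ∀ (i : Fin k) (j : Fin (A i)), dsExcess (.inr (.inl ⟨i, j⟩) : DSVertex C k m A B) =
      ((j.val : ℤ) + 1) * ((j.val + 1) + ((n : ℤ) - 1 - 2 * A i)) := by
    intro i j
    rw [dsExcess, ← ha, ← hb, hn']
    ring
  have valB : ∀ (i : Fin m) (j : Fin (B i)), dsExcess (.inr (.inr ⟨i, j⟩) : DSVertex C k m A B) =
      ((j.val : ℤ) + 1) * ((j.val + 1) + ((n : ℤ) - 1 - 2 * B i)) + C * (a - b) := by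
    intro i j
    rw [dsExcess, ← ha, ← hb, hn']
    ring
  have leA : ∀ i, (A i : ℤ) ≤ a := by
    intro i
    rw [← hcA]
    exact_mod_cast Finset.single_le_sum (fun _ _ => Nat.zero_le _) (Finset.mem_univ i)
  have leB : ∀ i, (B i : ℤ) ≤ b := by
    intro i
    rw [← hcB]
    exact_mod_cast Finset.single_le_sum (fun _ _ => Nat.zero_le _) (Finset.mem_univ i)
  have toFin : ∀ {N : ℕ} {s : ℤ}, 1 ≤ s → s ≤ N → ∃ j : Fin N, (j.val : ℤ) + 1 = s := by
    intro N s h1 h2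
    exact ⟨⟨(s - 1).toNat, by omega⟩, by simp only; omega⟩
  constructor
  · intro h
    refine ⟨?_, ?_, ?_, ?_, ?_, ?_, ?_, ?_, ?_⟩
    · intro i i' hii
      have := @h (.inr (.inl ⟨i, ⟨0, hA i⟩⟩)) (.inr (.inl ⟨i', ⟨0, hA i'⟩⟩)) (by
        rw [valA, valA]
        simp only [hii])
      simp only [Sum.inr.injEq, Sum.inl.injEq, Sigma.mk.injEq] at this
      exact this.1
    · intro i i' hii
      have := @h (.inr (.inr ⟨i, ⟨0, hB i⟩⟩)) (.inr (.inr ⟨i', ⟨0, hB i'⟩⟩)) (by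
        rw [valB, valB]
        simp only [hii])
      simp only [Sum.inr.injEq, Sigma.mk.injEq] at this
      exact this.1
    · intro i
      by_contra! hlt
      have := leA i
      obtain ⟨j, hj⟩ := toFin (N := A i) (s := 2 * A i + 1 - n) (by omega) (by omega)
      have := @h (.inr (.inl ⟨i, j⟩)) (.inl 0) (by
        rw [valA, valI, hj, Fin.val_zero]
        push_cast
        ring)
      simp at this
    · intro i
      by_contra! hlt
      have := leB i
      obtain ⟨j, hj⟩ := toFin (N := B i) (s := 2 * B i + 1 - n) (by omega) (by omega)
      have := @h (.inr (.inr ⟨i, j⟩)) (.inl (Fin.last C)) (by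
        rw [valB, valI, hj, Fin.val_last, hn']
        ring)
      simp at this
    · by_contra! hlt
      have hc : (((n - 1 - 2 * a).toNat : ℕ) : ℤ) = n - 1 - 2 * a := by omega
      have := @h (.inl ⟨(n - 1 - 2 * a).toNat, by omega⟩) (.inl 0) (by
        rw [valI, valI, Fin.val_zero]
        simp only [hc]
        push_cast
        ring)
      simp only [Sum.inl.injEq, Fin.ext_iff, Fin.val_zero] at this
      omega
    · rintro i i' hii ⟨s, t, ⟨hs1, hs2⟩, ⟨ht1, ht2⟩, heq⟩
      obtain ⟨j, rfl⟩ := toFin hs1 hs2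
      obtain ⟨j', rfl⟩ := toFin ht1 ht2
      have := @h (.inr (.inl ⟨i, j⟩)) (.inr (.inl ⟨i', j'⟩)) (by
        rw [valA, valA, heq, add_zero])
      simp only [Sum.inr.injEq, Sum.inl.injEq, Sigma.mk.injEq] at this
      exact hii.ne this.1
    · rintro i i' hii ⟨s, t, ⟨hs1, hs2⟩, ⟨ht1, ht2⟩, heq⟩
      obtain ⟨j, rfl⟩ := toFin hs1 hs2
      obtain ⟨j', rfl⟩ := toFin ht1 ht2
      have := @h (.inr (.inr ⟨i, j⟩)) (.inr (.inr ⟨i', j'⟩)) (by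
        rw [valB, valB, heq, add_zero])
      simp only [Sum.inr.injEq, Sigma.mk.injEq] at this
      exact hii.ne this.1
    · rintro i ⟨s, t, ⟨hs1, hs2⟩, ⟨ht1, ht2⟩, heq⟩
      obtain ⟨j, rfl⟩ := toFin hs1 hs2
      obtain ⟨j', rfl⟩ := toFin ht1 ht2
      have := @h (.inr (.inl ⟨i, j⟩)) (.inl j'.succ) (by
        rw [valA, valI, heq, add_zero, Fin.val_succ]
        push_cast
        rfl)
      simp at this
    · rintro i i' ⟨s, t, ⟨hs1, hs2⟩, ⟨ht1, ht2⟩, heq⟩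
      obtain ⟨j, rfl⟩ := toFin hs1 hs2
      obtain ⟨j', rfl⟩ := toFin ht1 ht2
      have := @h (.inr (.inl ⟨i, j⟩)) (.inr (.inr ⟨i', j'⟩)) (by
        rw [valA, valB, heq])
      simp at this
  · rintro ⟨-, -, hA2, hB2, hna2, h3, h4, h5, h6⟩
    have hAA : ∀ i i' j j', i < i' → dsExcess (.inr (.inl ⟨i, j⟩) : DSVertex C k m A B) ≠
        dsExcess (.inr (.inl ⟨i', j'⟩) : DSVertex C k m A B) := by
      intro i i' j j' hii heq
      rw [valA, valA] at heq
      exact h3 i i' hii ⟨j.val + 1, j'.val + 1, by omega, by omega, by rw [heq, add_zero]⟩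
    have hBB : ∀ i i' j j', i < i' → dsExcess (.inr (.inr ⟨i, j⟩) : DSVertex C k m A B) ≠
        dsExcess (.inr (.inr ⟨i', j'⟩) : DSVertex C k m A B) := by
      intro i i' j j' hii heq
      rw [valB, valB, add_left_inj] at heq
      exact h4 i i' hii ⟨j.val + 1, j'.val + 1, by omega, by omega, by rw [heq, add_zero]⟩
    have hAB' : ∀ i i' j j', dsExcess (.inr (.inl ⟨i, j⟩) : DSVertex C k m A B) ≠
        dsExcess (.inr (.inr ⟨i', j'⟩) : DSVertex C k m A B) := by
      intro i i' j j' heq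
      rw [valA, valB] at heq
      exact h6 i i' ⟨j.val + 1, j'.val + 1, by omega, by omega, heq⟩
    have hAI : ∀ i j c, dsExcess (.inr (.inl ⟨i, j⟩) : DSVertex C k m A B) ≠
        dsExcess (.inl c : DSVertex C k m A B) := by
      intro i j c heq
      rw [valA, valI] at heq
      rcases Nat.eq_zero_or_pos c.val with hc | hc
      · have := hA2 i
        rw [hc, Nat.cast_zero, zero_mul] at heq
        rcases mul_eq_zero.1 heq with h | h <;> omega
      · exact h5 i ⟨j.val + 1, c.val, by omega, by omega, by rw [heq, add_zero]⟩
    have hBI : ∀ i j c, dsExcess (.inr (.inr ⟨i, j⟩) : DSVertex C k m A B) ≠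
        dsExcess (.inl c : DSVertex C k m A B) := by
      intro i j c heq
      rw [valB, valI] at heq
      have := hB2 i
      have hpos : 0 < ((j.val : ℤ) + 1) * ((j.val + 1) + ((n : ℤ) - 1 - 2 * B i)) :=
        mul_pos (by omega) (by omega)
      have hle : (c.val : ℤ) * (c.val + (2 * a - n + 1)) ≤ C * (a - b) := by
        rcases Nat.eq_zero_or_pos c.val with hc | hc
        · rw [hc, Nat.cast_zero, zero_mul]
          exact mul_nonneg (by omega) (by omega)
        · exact mul_le_mul (by omega) (by omega) (by omega) (by omega)
      omega
    intro x y hxy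
    rcases x with c | ⟨i, j⟩ | ⟨i, j⟩ <;> rcases y with c' | ⟨i', j'⟩ | ⟨i', j'⟩
    · rw [valI, valI] at hxy
      have : (c.val : ℤ) = c'.val := by
        have : ((c.val : ℤ) - c'.val) * (c.val + c'.val + (2 * a - n + 1)) = 0 := by linarith
        rcases mul_eq_zero.1 this with h | h <;> omega
      rw [Fin.ext (Int.ofNat_inj.1 this)]
    · exact absurd hxy.symm (hAI _ _ _)
    · exact absurd hxy.symm (hBI _ _ _)
    · exact absurd hxy (hAI _ _ _)
    · rcases lt_trichotomy i i' with h | rfl | h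
      · exact absurd hxy (hAA _ _ _ _ h)
      · rw [valA, valA] at hxy
        have := hA2 i
        have : (j.val : ℤ) = j'.val := by
          have : ((j.val : ℤ) - j'.val) * (j.val + j'.val + 2 + ((n : ℤ) - 1 - 2 * A i)) = 0 := by
            linarith
          rcases mul_eq_zero.1 this with h | h <;> omega
        rw [Fin.ext (Int.ofNat_inj.1 this)]
      · exact absurd hxy.symm (hAA _ _ _ _ h)
    · exact absurd hxy (hAB' _ _ _ _)
    · exact absurd hxy (hBI _ _ _)
    · exact absurd hxy.symm (hAB' _ _ _ _)
    · rcases lt_trichotomy i i' with h | rfl | h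
      · exact absurd hxy (hBB _ _ _ _ h)
      · rw [valB, valB] at hxy
        have := hB2 i
        have : (j.val : ℤ) = j'.val := by
          have : ((j.val : ℤ) - j'.val) * (j.val + j'.val + 2 + ((n : ℤ) - 1 - 2 * B i)) = 0 := by
            linarith
          rcases mul_eq_zero.1 this with h | h <;> omega
        rw [Fin.ext (Int.ofNat_inj.1 this)]
      · exact absurd hxy.symm (hBB _ _ _ _ h)

/-- Complete characterization of transmission irregular double starlike trees
(Theorem 3 of the paper). -/
theorem doubleStarlike_TI_characterization (C k m : ℕ) (hC : 0 < C)
    (hk : 2 ≤ k) (hm : 2 ≤ m) (A : Fin k → ℕ) (B : Fin m → ℕ)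
    (hA : ∀ i, 0 < A i) (hB : ∀ i, 0 < B i)
    (hAB : ∑ i, B i ≤ ∑ i, A i)
    (n : ℕ) (hn : n = 1 + C + (∑ i, A i) + ∑ i, B i)
    (α : Fin k → Fin k → ℤ) (β : Fin m → Fin m → ℤ)
    (γ : Fin k → ℤ) (δ : Fin k → Fin m → ℤ)
    (hα : ∀ i j, α i j = ((n : ℤ) - 1 - (A i : ℤ) - (A j : ℤ)) * ((A j : ℤ) - (A i : ℤ)))
    (hβ : ∀ i j, β i j = ((n : ℤ) - 1 - (B i : ℤ) - (B j : ℤ)) * ((B j : ℤ) - (B i : ℤ)))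
    (hγ : ∀ i, γ i = ((n : ℤ) - 1 - (A i : ℤ) - ∑ l, (A l : ℤ)) * ((∑ l, (A l : ℤ)) - (A i : ℤ)))
    (hδ : ∀ i j, δ i j = ((n : ℤ) - 1 - (A i : ℤ) - (B j : ℤ)) * ((B j : ℤ) - (A i : ℤ))
        + (C : ℤ) * ((∑ l, (A l : ℤ)) - ∑ l, (B l : ℤ))) :
    TransmissionIrregular (doubleStarlikeTree C k m A B) ↔
      (Function.Injective A ∧ Function.Injective B ∧
       (∀ i, 2 * A i < n) ∧ (∀ i, 2 * B i < n) ∧ n < 2 * (1 + ∑ i, A i) ∧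
       (∀ i j : Fin k, i < j →
          ¬ ∃ p : ℤ, 0 < p ∧ p ∣ α i j ∧ Real.sqrt |((α i j : ℤ) : ℝ)| < (p : ℝ) ∧
            ((p ≡ α i j / p [ZMOD 2]) ↔ Odd n) ∧
            (gFun ((α i j : ℤ) : ℝ) ((n : ℝ) + 1 - 2 * (A i : ℝ)) ≤ ((p : ℝ) : EReal) ∧
              ((p : ℝ) : EReal) ≤ gFun ((α i j : ℤ) : ℝ) ((n : ℝ) - 1)) ∧
            (gFun ((α j i : ℤ) : ℝ) ((n : ℝ) + 1 - 2 * (A j : ℝ)) ≤ ((p : ℝ) : EReal) ∧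
              ((p : ℝ) : EReal) ≤ gFun ((α j i : ℤ) : ℝ) ((n : ℝ) - 1))) ∧
       (∀ i j : Fin m, i < j →
          ¬ ∃ p : ℤ, 0 < p ∧ p ∣ β i j ∧ Real.sqrt |((β i j : ℤ) : ℝ)| < (p : ℝ) ∧
            ((p ≡ β i j / p [ZMOD 2]) ↔ Odd n) ∧
            (gFun ((β i j : ℤ) : ℝ) ((n : ℝ) + 1 - 2 * (B i : ℝ)) ≤ ((p : ℝ) : EReal) ∧
              ((p : ℝ) : EReal) ≤ gFun ((β i j : ℤ) : ℝ) ((n : ℝ) - 1)) ∧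
            (gFun ((β j i : ℤ) : ℝ) ((n : ℝ) + 1 - 2 * (B j : ℝ)) ≤ ((p : ℝ) : EReal) ∧
              ((p : ℝ) : EReal) ≤ gFun ((β j i : ℤ) : ℝ) ((n : ℝ) - 1))) ∧
       (∀ i : Fin k,
          ¬ ∃ p : ℤ, 0 < p ∧ p ∣ γ i ∧ Real.sqrt |((γ i : ℤ) : ℝ)| < (p : ℝ) ∧
            ((p ≡ γ i / p [ZMOD 2]) ↔ Odd n) ∧
            (gFun ((γ i : ℤ) : ℝ) ((n : ℝ) + 1 - 2 * (A i : ℝ)) ≤ ((p : ℝ) : EReal) ∧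
              ((p : ℝ) : EReal) ≤ gFun ((γ i : ℤ) : ℝ) ((n : ℝ) - 1)) ∧
            (gFun ((-γ i : ℤ) : ℝ) (2 * (∑ l, (A l : ℝ)) - (n : ℝ) + 3) ≤ ((p : ℝ) : EReal) ∧
              ((p : ℝ) : EReal) ≤
                gFun ((-γ i : ℤ) : ℝ) (2 * (∑ l, (A l : ℝ)) + 2 * (C : ℝ) - (n : ℝ) + 1))) ∧
       (∀ (i : Fin k) (j : Fin m),
          ¬ ∃ p : ℤ, 0 < p ∧ p ∣ δ i j ∧ Real.sqrt |((δ i j : ℤ) : ℝ)| < (p : ℝ) ∧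
            ((p ≡ δ i j / p [ZMOD 2]) ↔ Odd n) ∧
            (gFun ((δ i j : ℤ) : ℝ) ((n : ℝ) + 1 - 2 * (A i : ℝ)) ≤ ((p : ℝ) : EReal) ∧
              ((p : ℝ) : EReal) ≤ gFun ((δ i j : ℤ) : ℝ) ((n : ℝ) - 1)) ∧
            (gFun ((-δ i j : ℤ) : ℝ) ((n : ℝ) + 1 - 2 * (B j : ℝ)) ≤ ((p : ℝ) : EReal) ∧
              ((p : ℝ) : EReal) ≤ gFun ((-δ i j : ℤ) : ℝ) ((n : ℝ) - 1)))) := by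
  have hn' : (n : ℤ) = 1 + C + ∑ l, (A l : ℤ) + ∑ l, (B l : ℤ) := by
    rw [hn]
    push_cast
    rfl
  rw [transmissionIrregular_iff_dsExcess_injective, dsExcess_injective_iff hA hB hAB n hn]
  refine and_congr_right fun _ => and_congr_right fun _ => and_congr_right fun hA2 =>
    and_congr_right fun hB2 => and_congr_right fun hn2 => and_congr ?_ (and_congr ?_
      (and_congr ?_ ?_))
  · refine forall_congr' fun i => forall_congr' fun j => imp_congr_right fun _ => not_congr ?_
    have hi := hA2 i
    have hj := hA2 j
    refine (exists_divisor_iff_exists_eq n _ _ _ _ _ _ (by omega) (by omega) (by omega)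
      (by omega) ?_ ?_ ?_ ?_ ?_ ?_).symm
    · rw [hα]
      ring
    all_goals try simp only [hα]
    all_goals push_cast; ring
  · refine forall_congr' fun i => forall_congr' fun j => imp_congr_right fun _ => not_congr ?_
    have hi := hB2 i
    have hj := hB2 j
    refine (exists_divisor_iff_exists_eq n _ _ _ _ _ _ (by omega) (by omega) (by omega)
      (by omega) ?_ ?_ ?_ ?_ ?_ ?_).symm
    · rw [hβ]
      ring
    all_goals try simp only [hβ]
    all_goals push_cast; ring
  · refine forall_congr' fun i => not_congr ?_
    have hi := hA2 i
    have hn2' : (n : ℤ) < 2 * (1 + ∑ l, (A l : ℤ)) := by exact_mod_cast hn2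
    refine (exists_divisor_iff_exists_eq n _ _ _ _ _ _ (by omega) (by omega) (by omega)
      (by omega) ?_ ?_ ?_ ?_ ?_ ?_).symm
    · rw [hγ]
      ring
    all_goals push_cast; ring
  · refine forall_congr' fun i => forall_congr' fun j => not_congr ?_
    have hi := hA2 i
    have hj := hB2 j
    refine (exists_divisor_iff_exists_eq n _ _ _ _ _ _ (by omega) (by omega) (by omega)
      (by omega) ?_ ?_ ?_ ?_ ?_ ?_).symm
    · rw [hδ, hn']
      ring
    all_goals push_cast; ring
end

section
/- For every nonnegative integer t, the X-tree X(7 + 12t, 6 + 12t, 3 + 12t, 1), i.e., the starlike tree S(7 + 12t, 6 + 12t, 3 + 12t, 1), is transmission irregular. -/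
/-- A function that vanishes only at `u`, grows by at most one along edges, and can be decreased
by one at every other vertex, is the distance from `u`. -/
theorem SimpleGraph.dist_eq_of_levels {V : Type*} (G : SimpleGraph V) (u : V) (f : V → ℕ)
    (hu : f u = 0) (hadj : ∀ v w, G.Adj v w → f w ≤ f v + 1)
    (hpred : ∀ v, v ≠ u → ∃ w, G.Adj w v ∧ f v = f w + 1) (v : V) : G.dist u v = f v := by
  have walk_of_level : ∀ n v, f v = n → ∃ p : G.Walk u v, p.length = n := by
    intro n
    induction n with
    | zero =>
      intro v hv
      by_cases h : v = u
      · subst h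
        exact ⟨.nil, rfl⟩
      · obtain ⟨w, -, hw⟩ := hpred v h
        omega
    | succ n ih =>
      intro v hv
      have h : v ≠ u := by
        rintro rfl
        omega
      obtain ⟨w, hwv, hw⟩ := hpred v h
      obtain ⟨p, hp⟩ := ih w (by omega)
      exact ⟨p.concat hwv, by simp [hp]⟩
  have level_le_length : ∀ {a b : V} (p : G.Walk a b), f b ≤ f a + p.length := by
    intro a b p
    induction p with
    | nil => simp
    | cons h p ih =>
      have := hadj _ _ h
      rw [SimpleGraph.Walk.length_cons]
      omega
  obtain ⟨p, hp⟩ := walk_of_level _ v rfl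
  obtain ⟨q, hq⟩ := SimpleGraph.Reachable.exists_walk_length_eq_dist ⟨p⟩
  have h₁ := SimpleGraph.dist_le p
  have h₂ := level_le_length q
  omega

namespace starlikeTree

variable {k : ℕ} {A : Fin k → ℕ}

theorem adj_none_some {i : Fin k} {j : Fin (A i)} :
    (starlikeTree k A).Adj none (some ⟨i, j⟩) ↔ j.val = 0 := by
  simp [starlikeTree]

theorem adj_some_some {i i' : Fin k} {j : Fin (A i)} {j' : Fin (A i')} :
    (starlikeTree k A).Adj (some ⟨i, j⟩) (some ⟨i', j'⟩) ↔
      i = i' ∧ (j.val + 1 = j'.val ∨ j'.val + 1 = j.val) := by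
  simp only [starlikeTree, SimpleGraph.fromRel_adj, Fin.val_inj]
  constructor
  · rintro ⟨-, ⟨h, h'⟩ | ⟨h, h'⟩⟩
    · exact ⟨h, .inl h'⟩
    · exact ⟨h.symm, .inr h'⟩
  · rintro ⟨rfl, h⟩
    refine ⟨?_, h.imp (⟨rfl, ·⟩) (⟨rfl, ·⟩)⟩
    intro he
    simp only [Option.some.injEq, Sigma.mk.injEq, heq_eq_eq, true_and] at he
    subst he
    omega

/-- The distance from the center. -/
def depth : Option ((i : Fin k) × Fin (A i)) → ℕ
  | none => 0
  | some ⟨_, j⟩ => j.val + 1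

/-- The distance from the vertex `some ⟨i, j⟩`. -/
def distFrom (i : Fin k) (j : ℕ) : Option ((i : Fin k) × Fin (A i)) → ℕ
  | none => j + 1
  | some ⟨i', j'⟩ => if i' = i then (j - j'.val) + (j'.val - j) else j + j'.val + 2

theorem dist_none (v : Option ((i : Fin k) × Fin (A i))) :
    (starlikeTree k A).dist none v = depth v := by
  refine SimpleGraph.dist_eq_of_levels _ none depth rfl ?_ ?_ v
  · rintro (_ | ⟨i, j⟩) (_ | ⟨i', j'⟩) h
    · simp [depth]
    · rw [adj_none_some] at h
      simp [depth, h]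
    · simp [depth]
    · rw [adj_some_some] at h
      simp only [depth]
      omega
  · rintro (_ | ⟨i, ⟨_ | j, hj⟩⟩) h
    · exact absurd rfl h
    · exact ⟨none, adj_none_some.2 rfl, rfl⟩
    · exact ⟨some ⟨i, ⟨j, by omega⟩⟩, adj_some_some.2 ⟨rfl, .inl rfl⟩, rfl⟩

theorem dist_some (i : Fin k) (j : Fin (A i)) (v : Option ((i : Fin k) × Fin (A i))) :
    (starlikeTree k A).dist (some ⟨i, j⟩) v = distFrom i j.val v := by
  refine SimpleGraph.dist_eq_of_levels _ _ _ (by simp [distFrom]) ?_ ?_ v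
  · rintro (_ | ⟨i₁, j₁⟩) (_ | ⟨i₂, j₂⟩) h
    · simp
    · rw [adj_none_some] at h
      simp only [distFrom]
      split_ifs <;> omega
    · rw [SimpleGraph.adj_comm, adj_none_some] at h
      simp only [distFrom]
      split_ifs <;> omega
    · rw [adj_some_some] at h
      obtain ⟨rfl, h⟩ := h
      simp only [distFrom]
      split_ifs <;> omega
  · rintro (_ | ⟨i', j'⟩) h
    · refine ⟨some ⟨i, ⟨0, j.pos⟩⟩, (adj_none_some.2 rfl).symm, ?_⟩
      simp [distFrom]
    · by_cases hi : i' = i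
      · subst hi
        have hne : j'.val ≠ j.val := fun he => h (by rw [Fin.ext he])
        rcases Nat.lt_or_gt_of_ne hne with hlt | hlt
        · refine ⟨some ⟨i', ⟨j'.val + 1, by omega⟩⟩, adj_some_some.2 ⟨rfl, .inr rfl⟩, ?_⟩
          simp only [distFrom, if_true]
          omega
        · refine ⟨some ⟨i', ⟨j'.val - 1, by omega⟩⟩,
            adj_some_some.2 ⟨rfl, .inl (Nat.sub_add_cancel (by omega))⟩, ?_⟩
          simp only [distFrom, if_true]
          omega
      · obtain ⟨_ | j', hj'⟩ := j'
        · exact ⟨none, adj_none_some.2 rfl, by simp [distFrom, hi]⟩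
        · refine ⟨some ⟨i', ⟨j', by omega⟩⟩, adj_some_some.2 ⟨rfl, .inl rfl⟩, ?_⟩
          simp only [distFrom, if_neg hi]
          omega

theorem sum_dist_path (a j : ℕ) (hj : j < a) :
    ∑ x ∈ Finset.range a, ((j - x) + (x - j)) + (j + 1) * (a + 1) =
      ∑ x ∈ Finset.range a, (x + 1) + (j + 1) ^ 2 := by
  have initial : ∀ m, m ≤ j + 1 → ∑ x ∈ Finset.range m, ((j - x) + (x - j)) +
      ∑ x ∈ Finset.range m, (x + 1) = (j + 1) * m := by
    intro m hm
    induction m with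
    | zero => simp
    | succ m ih =>
      have := ih (by omega)
      rw [Finset.sum_range_succ, Finset.sum_range_succ, Nat.mul_succ]
      omega
  induction a, hj using Nat.le_induction with
  | base =>
    have h := initial (j + 1) le_rfl
    have hs := Finset.sum_range_id_mul_two (j + 1 + 1)
    rw [Finset.sum_range_succ'] at hs
    simp only [Nat.succ_eq_add_one] at *
    simp only [add_zero, Nat.add_sub_cancel] at hs
    nlinarith
  | succ a ha ih =>
    rw [Finset.sum_range_succ, Finset.sum_range_succ]
    have : (j - a) + (a - j) + (j + 1) = a + 1 := by omega
    nlinarith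

theorem transmission_none :
    transmission (starlikeTree k A) none = ∑ i, ∑ x ∈ Finset.range (A i), (x + 1) := by
  simp only [transmission, dist_none, Fintype.sum_option, Fintype.sum_sigma, depth, zero_add]
  exact Finset.sum_congr rfl fun i _ => Fin.sum_univ_eq_sum_range (fun x => x + 1) (A i)

theorem transmission_some (i : Fin k) (j : Fin (A i)) :
    transmission (starlikeTree k A) (some ⟨i, j⟩) + (j.val + 1) * (2 * A i + 1) =
      transmission (starlikeTree k A) none +
        (j.val + 1) * ((1 + ∑ i', A i') + (j.val + 1)) := by
  have branch : ∀ i', ∑ x : Fin (A i'), distFrom i j.val (some ⟨i', x⟩) +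
      (if i' = i then (j.val + 1) * (2 * A i + 1) else 0) =
      ∑ x ∈ Finset.range (A i'), (x + 1) + (j.val + 1) * A i' +
      (if i' = i then (j.val + 1) ^ 2 else 0) := by
    intro i'
    by_cases h : i' = i
    · subst h
      simp only [distFrom, if_true]
      rw [Fin.sum_univ_eq_sum_range (fun x => (j.val - x) + (x - j.val))]
      have := sum_dist_path (A i') j j.isLt
      linarith
    · simp only [distFrom, if_neg h]
      rw [Fin.sum_univ_eq_sum_range (fun x => j.val + x + 2),
        Finset.sum_congr rfl (fun x _ => show j.val + x + 2 = (x + 1) + (j.val + 1) by ring),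
        Finset.sum_add_distrib]
      simp [mul_comm]
  have total := Finset.sum_congr (rfl : (Finset.univ : Finset (Fin k)) = _) fun i' _ => branch i'
  simp only [Finset.sum_add_distrib, Finset.sum_ite_eq', Finset.mem_univ, if_true,
    ← Finset.mul_sum] at total
  rw [transmission_none]
  simp only [transmission, dist_some, Fintype.sum_option, Fintype.sum_sigma, Finset.sum_add_distrib]
  have center : distFrom (A := A) i j.val none = j.val + 1 := rfl
  rw [center]
  linarith

end starlikeTree

theorem mul_add_injective {a b s : ℕ} (h : a * (a + s) = b * (b + s)) : a = b := by
  rcases Nat.lt_trichotomy a b with hlt | rfl | hlt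
  · nlinarith
  · rfl
  · nlinarith

theorem mul_add_ne_first_second {a b s : ℕ} (hb : 0 < b) : a * (a + 3 + s) ≠ b * (b + 5 + s) := by
  intro h
  rcases Nat.lt_or_ge b a with hlt | hle
  · obtain ⟨m, rfl⟩ := Nat.exists_eq_add_of_lt hlt
    nlinarith [Nat.zero_le (m * b), Nat.zero_le (m * s), Nat.zero_le (m * m)]
  · nlinarith

theorem mul_add_ne_first_third {a b t : ℕ} (hb : 0 < b) (hb' : b ≤ 3 + 12 * t) :
    a * (a + 3 + 12 * t) ≠ b * (b + 11 + 12 * t) := by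
  intro h
  rcases Nat.lt_or_ge b a with hlt | hle
  · obtain ⟨m, rfl⟩ := Nat.exists_eq_add_of_lt hlt
    rcases m with _ | _ | _ | m
    · ring_nf at h; omega
    · ring_nf at h; omega
    · ring_nf at h; omega
    · nlinarith [Nat.zero_le (m * b), Nat.zero_le (m * t), Nat.zero_le (m * m)]
  · nlinarith

theorem mul_add_ne_second_third {a b t : ℕ} (hb : 0 < b) (hb' : b ≤ 3 + 12 * t) :
    a * (a + 5 + 12 * t) ≠ b * (b + 11 + 12 * t) := by
  intro h
  rcases Nat.lt_or_ge b a with hlt | hle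
  · obtain ⟨m, rfl⟩ := Nat.exists_eq_add_of_lt hlt
    rcases m with _ | _ | m
    · ring_nf at h; omega
    · ring_nf at h; omega
    · nlinarith [Nat.zero_le (m * b), Nat.zero_le (m * t), Nat.zero_le (m * m)]
  · nlinarith

theorem mul_add_ne_fourth {a c t : ℕ} (hc : c = 3 ∨ c = 5 ∨ c = 11) :
    a * (a + c + 12 * t) ≠ 16 + 36 * t := by
  intro h
  rcases a with _ | _ | _ | a
  · omega
  · omega
  · omega
  · have : 3 * (3 + c + 12 * t) ≤ (a + 1 + 1 + 1) * (a + 1 + 1 + 1 + c + 12 * t) :=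
      Nat.mul_le_mul (by omega) (by omega)
    omega

/-- For every nonnegative integer `t`, the X-tree `X(7+12t, 6+12t, 3+12t, 1)` is
transmission irregular. -/
theorem xTree_family_one_TI (t : ℕ) :
    TransmissionIrregular (starlikeTree 4 ![7 + 12 * t, 6 + 12 * t, 3 + 12 * t, 1]) := by
  set A := ![7 + 12 * t, 6 + 12 * t, 3 + 12 * t, 1]
  let c : Fin 4 → ℕ := ![3 + 12 * t, 5 + 12 * t, 11 + 12 * t, 15 + 36 * t]
  have excess : ∀ (i : Fin 4) (j : Fin (A i)), transmission (starlikeTree 4 A) (some ⟨i, j⟩) =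
      transmission (starlikeTree 4 A) none + (j.val + 1) * (j.val + 1 + c i) := by
    intro i j
    have h := starlikeTree.transmission_some i j
    have hc : 1 + ∑ i', A i' = c i + (2 * A i + 1) := by
      rw [Fin.sum_univ_four]
      fin_cases i <;> simp [A, c] <;> ring
    rw [hc] at h
    linarith
  have branch_eq : ∀ (i i' : Fin 4) (a b : ℕ), a < A i → b < A i' →
      (a + 1) * (a + 1 + c i) = (b + 1) * (b + 1 + c i') → i ≤ i' → i = i' := by
    intro i i' a b ha hb h hle
    have h12 := mul_add_ne_first_second (a := a + 1) (b := b + 1) (s := 12 * t) b.succ_pos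
    have h13 := mul_add_ne_first_third (a := a + 1) (b := b + 1) (t := t) b.succ_pos
    have h23 := mul_add_ne_second_third (a := a + 1) (b := b + 1) (t := t) b.succ_pos
    have h4 := fun c => mul_add_ne_fourth (a := a + 1) (c := c) (t := t)
    simp only [add_assoc] at h h12 h13 h23 h4
    fin_cases i <;> fin_cases i' <;> first | rfl | (exact absurd hle (by decide)) | skip
    all_goals simp [A, c] at ha hb h
    · exact absurd h h12
    · exact absurd h (h13 (by omega))
    · subst hb
      exact absurd (h.trans (by ring)) (h4 3 (by simp))
    · exact absurd h (h23 (by omega))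
    · subst hb
      exact absurd (h.trans (by ring)) (h4 5 (by simp))
    · subst hb
      exact absurd (h.trans (by ring)) (h4 11 (by simp))
  rintro (_ | ⟨i, j⟩) (_ | ⟨i', j'⟩) h
  · rfl
  · rw [excess] at h
    nlinarith
  · rw [excess] at h
    nlinarith
  · rw [excess, excess] at h
    have h := Nat.add_left_cancel h
    have hi : i = i' := by
      rcases le_total i i' with hle | hle
      · exact branch_eq i i' _ _ j.isLt j'.isLt h hle
      · exact (branch_eq i' i _ _ j'.isLt j.isLt h.symm hle).symm
    subst hi
    have hj : j = j' := Fin.ext (Nat.succ_injective (mul_add_injective h))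
    rw [hj]
end
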